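/- arXiv:1510.00221 — 8 statements merged into one kernel-verified Lean document; each statement's English description precedes it below -/
import Mathlib

section
/- Let F : ℂ^n → ℂ^n be a dominant polynomial mapping. Then the asymptotic set S_F is either empty or a hypersurface: if S_F ≠ ∅, there exists a nonconstant polynomial P in n complex variables such that S_F = {x ∈ ℂ^n : P(x) = 0}. -/
open Filter Topology

/-- The asymptotic set of a mapping `F : ℂⁿ → ℂⁿ`. -/
def asymptoticSet {n : ℕ} (F : (Fin n → ℂ) → (Fin n → ℂ)) : Set (Fin n → ℂ) :=
  {a | ∃ ξ : ℕ → (Fin n → ℂ),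
    Tendsto (fun k => ‖ξ k‖) atTop atTop ∧ Tendsto (fun k => F (ξ k)) atTop (nhds a)}

theorem Algebra.IsAlgebraic.exists_pow_smul_isIntegral (A B : Type*) [CommRing A] [IsDomain A]
    [CommRing B] [Algebra A B] [Algebra.IsAlgebraic A B] [Algebra.FiniteType A B] :
    ∃ d : A, d ≠ 0 ∧ ∀ b : B, ∃ N : ℕ, IsIntegral A (d ^ N • b) := by
  classical
  obtain ⟨G, hG⟩ := Algebra.FiniteType.out (R := A) (A := B)
  choose y hy0 hy using fun b : B =>
    (Algebra.IsAlgebraic.isAlgebraic (R := A) b).exists_integral_multiple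
  refine ⟨∏ g ∈ G, y g, Finset.prod_ne_zero_iff.2 fun g _ => hy0 g, fun b => ?_⟩
  have hb : b ∈ Algebra.adjoin A (G : Set B) := hG ▸ Algebra.mem_top
  induction hb using Algebra.adjoin_induction with
  | mem g hg =>
    refine ⟨1, ?_⟩
    rw [pow_one, ← Finset.prod_erase_mul _ _ (Finset.mem_coe.1 hg), mul_smul]
    exact (hy g).smul _
  | algebraMap r =>
    exact ⟨0, by simpa using isIntegral_algebraMap⟩
  | add p q _ _ hp hq =>
    obtain ⟨M, hM⟩ := hp
    obtain ⟨N, hN⟩ := hq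
    refine ⟨M + N, ?_⟩
    rw [smul_add]
    refine IsIntegral.add ?_ ?_
    · rw [add_comm, pow_add, mul_smul]
      exact hM.smul _
    · rw [pow_add, mul_smul]
      exact hN.smul _
  | mul p q _ _ hp hq =>
    obtain ⟨M, hM⟩ := hp
    obtain ⟨N, hN⟩ := hq
    refine ⟨M + N, ?_⟩
    rw [pow_add, ← smul_mul_smul_comm]
    exact hM.mul hN

theorem Ideal.map_ne_top_of_pow_smul_isIntegral {S B : Type*} [CommRing S] [CommRing B]
    [Algebra S B] {d : S} (hd : ∀ b : B, ∃ N : ℕ, IsIntegral S (d ^ N • b))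
    {P : Ideal S} [P.IsPrime] (hker : RingHom.ker (algebraMap S B) ≤ P) (hdP : d ∉ P) :
    P.map (algebraMap S B) ≠ ⊤ := by
  let B' := integralClosure S B
  intro htop
  have key : ∀ b ∈ P.map (algebraMap S B), ∃ N : ℕ, ∃ b' ∈ P.map (algebraMap S B'),
      (b' : B) = d ^ N • b := by
    intro b hb
    induction hb using Submodule.span_induction with
    | mem x hx =>
      obtain ⟨p, hp, rfl⟩ := hx
      exact ⟨0, algebraMap S B' p, Ideal.mem_map_of_mem _ hp, by simp⟩
    | zero => exact ⟨0, 0, zero_mem _, by simp⟩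
    | add x y _ _ hx hy =>
      obtain ⟨M, x', hx', hxe⟩ := hx
      obtain ⟨N, y', hy', hye⟩ := hy
      refine ⟨M + N, d ^ N • x' + d ^ M • y', add_mem (Submodule.smul_of_tower_mem _ _ hx')
        (Submodule.smul_of_tower_mem _ _ hy'), ?_⟩
      push_cast
      rw [hxe, hye, smul_smul, smul_smul, smul_add, ← pow_add, ← pow_add, add_comm N M]
    | smul a x _ hx =>
      obtain ⟨M, x', hx', hxe⟩ := hx
      obtain ⟨N, hN⟩ := hd a
      refine ⟨N + M, (⟨d ^ N • a, hN⟩ : B') * x', Ideal.mul_mem_left _ _ hx', ?_⟩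
      push_cast
      rw [hxe, smul_mul_smul_comm, ← pow_add, smul_eq_mul]
  obtain ⟨N, b', hb', hbe⟩ := key 1 (htop ▸ Submodule.mem_top)
  have hinj : RingHom.ker (algebraMap S B') ≤ P := fun x hx => hker (by
    rw [RingHom.mem_ker] at hx ⊢
    exact congrArg (Subtype.val : B' → B) hx)
  obtain ⟨Q, -, -, hQ⟩ := Ideal.exists_ideal_over_prime_of_isIntegral (S := B') P ⊥ hinj
  have h1 : b' = algebraMap S B' (d ^ N) := Subtype.ext <| by
    rw [hbe, Algebra.smul_def, mul_one]; rfl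
  have h2 : P.map (algebraMap S B') ≤ Q := Ideal.map_le_iff_le_comap.2 hQ.ge
  have h3 : d ^ N ∈ Q.comap (algebraMap S B') := by
    rw [Ideal.mem_comap, ← h1]
    exact h2 hb'
  rw [hQ] at h3
  exact hdP (Ideal.IsPrime.mem_of_pow_mem ‹_› _ h3)

theorem Ideal.exists_algHom_le_ker {k B : Type*} [Field k] [IsAlgClosed k] [CommRing B]
    [Algebra k B] [Algebra.FiniteType k B] {J : Ideal B} (hJ : J ≠ ⊤) :
    ∃ χ : B →ₐ[k] k, ∀ b ∈ J, χ b = 0 := by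
  obtain ⟨M, hM, hJM⟩ := Ideal.exists_le_maximal J hJ
  let : Field (B ⧸ M) := Ideal.Quotient.field M
  have : Module.Finite k (B ⧸ M) := finite_of_finite_type_of_isJacobsonRing k (B ⧸ M)
  refine ⟨(IsAlgClosed.lift (R := k) (S := B ⧸ M)).comp (Ideal.Quotient.mkₐ k M), fun b hb => ?_⟩
  have : Ideal.Quotient.mkₐ k M b = 0 := Ideal.Quotient.eq_zero_iff_mem.2 (hJM hb)
  rw [AlgHom.comp_apply, this, map_zero]

theorem Polynomial.exists_prime_ker_eq_span {A B : Type*} [CommRing A] [IsDomain A]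
    [UniqueFactorizationMonoid A] [CommRing B] [IsDomain B] (Φ : Polynomial A →+* B)
    (hA : Function.Injective (Φ.comp Polynomial.C)) (hker : RingHom.ker Φ ≠ ⊥)
    (hX : Φ Polynomial.X ≠ 0) :
    ∃ h : Polynomial A, h.coeff 0 ≠ 0 ∧ RingHom.ker Φ = Ideal.span {h} := by
  obtain ⟨h, hh, hp⟩ := (RingHom.ker_isPrime Φ).exists_mem_prime_of_ne_bot hker
  have hh' : Φ h = 0 := hh
  refine ⟨h, fun h0 => ?_, le_antisymm (fun q hq => ?_) ?_⟩
  · obtain ⟨g, rfl⟩ := Polynomial.X_dvd_iff.2 h0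
    rcases hp.irreducible.isUnit_or_isUnit rfl with hu | hu
    · exact Polynomial.not_isUnit_X hu
    · rw [map_mul] at hh'
      exact (mul_ne_zero hX (hu.map Φ).ne_zero) hh'
  · rw [Ideal.mem_span_singleton]
    have hdeg : h.natDegree ≠ 0 := fun hd => by
      rw [Polynomial.eq_C_of_natDegree_eq_zero hd] at hh' hp
      have : h.coeff 0 = 0 := hA (by simpa using hh')
      rw [this, map_zero] at hp
      exact hp.ne_zero rfl
    have hprim := hp.irreducible.isPrimitive hdeg
    let K := FractionRing A
    let L := FractionRing B
    have hinj : Function.Injective ((algebraMap B L).comp (Φ.comp Polynomial.C)) :=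
      (IsFractionRing.injective B L).comp hA
    let ι : K →+* L := IsFractionRing.lift hinj
    let Ψ : Polynomial K →+* L := Polynomial.eval₂RingHom ι (algebraMap B L (Φ Polynomial.X))
    have hΨ : ∀ p : Polynomial A, Ψ (p.map (algebraMap A K)) = algebraMap B L (Φ p) := by
      intro p
      have : Ψ.comp (Polynomial.mapRingHom (algebraMap A K)) = (algebraMap B L).comp Φ := by
        ext a
        · simp [Ψ, ι]
        · simp [Ψ]
      exact congrArg (fun f : Polynomial A →+* L => f p) this
    refine hprim.dvd_of_fraction_map_dvd_fraction_map (K := K) ?_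
    by_contra hnd
    obtain ⟨u, v, huv⟩ := ((hprim.irreducible_iff_irreducible_map_fraction_map (K := K)).1
      hp.irreducible).coprime_iff_not_dvd.2 hnd
    have := congrArg Ψ huv
    rw [map_add, map_mul, map_mul, hΨ, hΨ, hh', RingHom.mem_ker.1 hq] at this
    simp at this
  · rw [Ideal.span_singleton_le_iff_mem]
    exact hh

/-- Evaluation of a polynomial in `T` with coefficients in `ℂ[σ]` at a point of `ℂ^σ × ℂ`. -/
noncomputable def evalAt {σ : Type*} (p : (σ → ℂ) × ℂ) : Polynomial (MvPolynomial σ ℂ) →+* ℂ :=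
  Polynomial.eval₂RingHom (MvPolynomial.eval p.1) p.2

section evalAt

variable {σ : Type*}

@[simp]
theorem evalAt_C (p : (σ → ℂ) × ℂ) (a : MvPolynomial σ ℂ) :
    evalAt p (Polynomial.C a) = MvPolynomial.eval p.1 a := by
  simp [evalAt]

@[simp]
theorem evalAt_X (p : (σ → ℂ) × ℂ) : evalAt p Polynomial.X = p.2 := by
  simp [evalAt]

theorem continuous_evalAt (h : Polynomial (MvPolynomial σ ℂ)) :
    Continuous fun p : (σ → ℂ) × ℂ => evalAt p h := by
  simp only [evalAt, Polynomial.coe_eval₂RingHom, Polynomial.eval₂_eq_sum_range]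
  refine continuous_finsetSum _ fun i _ => ?_
  exact ((MvPolynomial.continuous_eval _).comp continuous_fst).mul (continuous_snd.pow _)

theorem evalAt_zero (z : σ → ℂ) (h : Polynomial (MvPolynomial σ ℂ)) :
    evalAt (z, 0) h = MvPolynomial.eval z (h.coeff 0) := by
  simp [evalAt, Polynomial.eval₂_at_zero]

theorem exists_evalAt_ne_zero {h : Polynomial (MvPolynomial σ ℂ)} (hh : h ≠ 0) :
    ∃ p, evalAt p h ≠ 0 := by
  by_contra! hz
  refine hh (Polynomial.ext fun m => MvPolynomial.funext fun z => ?_)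
  have : h.map (MvPolynomial.eval z) = 0 := Polynomial.funext fun t => by
    simpa [evalAt, Polynomial.eval_map] using hz (z, t)
  simpa using congrArg (fun q => Polynomial.coeff q m) this

theorem exists_polynomial_eval_eq_evalAt (h : Polynomial (MvPolynomial σ ℂ)) (u c : σ → ℂ) :
    ∃ g : Polynomial ℂ, ∀ t, g.eval t = evalAt (u + t • c, t) h := by
  refine ⟨h.eval₂ (MvPolynomial.aeval fun j => Polynomial.C (u j) + Polynomial.X *
    Polynomial.C (c j)).toRingHom Polynomial.X, fun t => ?_⟩
  have : ((Polynomial.evalRingHom t).comp (Polynomial.eval₂RingHom (MvPolynomial.aeval fun j =>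
      Polynomial.C (u j) + Polynomial.X * Polynomial.C (c j)).toRingHom Polynomial.X)) =
      evalAt (u + t • c, t) := by
    ext j
    · simp
    · simp [mul_comm t]
    · simp
  exact congrArg (fun f : Polynomial (MvPolynomial σ ℂ) →+* ℂ => f h) this

/-- Persistence of a zero along lines in the direction `(c, 1)`. -/
theorem eventually_exists_evalAt_eq_zero {h : Polynomial (MvPolynomial σ ℂ)} {y c : σ → ℂ}
    (hy : evalAt (y, 0) h = 0) {t₁ : ℂ} (ht₁ : evalAt (y + t₁ • c, t₁) h ≠ 0)
    {U : Set ((σ → ℂ) × ℂ)} (hU : U ∈ 𝓝 (y, (0 : ℂ))) :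
    ∀ᶠ u in 𝓝 y, ∃ t, (u + t • c, t) ∈ U ∧ evalAt (u + t • c, t) h = 0 := by
  have hcont : Continuous fun q : (σ → ℂ) × ℂ => (q.1 + q.2 • c, q.2) := by fun_prop
  have hG : Continuous fun q : (σ → ℂ) × ℂ => evalAt (q.1 + q.2 • c, q.2) h :=
    (continuous_evalAt h).comp hcont
  have hU' : ∀ᶠ q in 𝓝 (y, (0 : ℂ)), (q.1 + q.2 • c, q.2) ∈ U :=
    hcont.continuousAt.eventually_mem (by simpa using hU)
  rw [nhds_prod_eq] at hU'
  obtain ⟨V, hV, W, hW, hVW⟩ := eventually_prod_iff.1 hU'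
  obtain ⟨g, hg⟩ := exists_polynomial_eval_eq_evalAt h y c
  have hg0 : g ≠ 0 := by
    rintro rfl
    exact ht₁ (by simpa using (hg t₁).symm)
  have hroots : ∀ᶠ t in 𝓝[≠] (0 : ℂ), g.eval t ≠ 0 := by
    have hfin : ({t | g.eval t = 0} \ {0}).Finite :=
      (Polynomial.finite_setOfPred_isRoot hg0).subset Set.sdiff_subset
    have h1 : ({t | g.eval t = 0} \ {0})ᶜ ∈ 𝓝 (0 : ℂ) :=
      hfin.isClosed.isOpen_compl.mem_nhds (by simp)
    filter_upwards [nhdsWithin_le_nhds h1, self_mem_nhdsWithin] with t ht ht0 h0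
    exact ht ⟨h0, ht0⟩
  rw [eventually_nhdsWithin_iff] at hroots
  obtain ⟨r, hr, hball⟩ := Metric.nhds_basis_closedBall.mem_iff.1 (hW.and hroots)
  have hne : ∀ t ∈ Metric.sphere (0 : ℂ) r, evalAt (y + t • c, t) h ≠ 0 := fun t ht => by
    rw [← hg]
    refine (hball (Metric.sphere_subset_closedBall ht)).2 ?_
    rintro rfl
    simp at ht
    exact hr.ne ht
  obtain ⟨δ, hδ, hδs⟩ : ∃ δ > 0, ∀ t ∈ Metric.sphere (0 : ℂ) r,
      δ < ‖evalAt (y + t • c, t) h‖ := by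
    have hc : ContinuousOn (fun t : ℂ => ‖evalAt (y + t • c, t) h‖) (Metric.sphere 0 r) :=
      (hG.comp (Continuous.prodMk_right y)).norm.continuousOn
    obtain ⟨t₂, ht₂, hmin⟩ := (isCompact_sphere (0 : ℂ) r).exists_isMinOn
      (NormedSpace.sphere_nonempty.2 hr.le) hc
    have := norm_pos_iff.2 (hne t₂ ht₂)
    exact ⟨_, half_pos this, fun t ht => (half_lt_self this).trans_le (hmin ht)⟩
  have hsphere : ∀ᶠ u in 𝓝 y, ∀ t ∈ Metric.sphere (0 : ℂ) r, δ < ‖evalAt (u + t • c, t) h‖ :=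
    (isCompact_sphere (0 : ℂ) r).eventually_forall_of_forall_eventually fun t ht =>
      (hG.norm.continuousAt (x := (y, t))).eventually (lt_mem_nhds (hδs t ht))
  have hcenter : ∀ᶠ u in 𝓝 y, ‖evalAt (u, 0) h‖ < δ / 3 := by
    have hc : Continuous fun u : σ → ℂ => ‖evalAt (u, 0) h‖ :=
      ((continuous_evalAt h).comp (Continuous.prodMk_left 0)).norm
    refine hc.continuousAt.eventually (gt_mem_nhds ?_)
    simpa [hy] using hδ
  filter_upwards [hV, hsphere, hcenter] with u huV hus huc
  obtain ⟨gu, hgu⟩ := exists_polynomial_eval_eq_evalAt h u c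
  have hgu0 : gu.eval 0 = evalAt (u, 0) h := by simp [hgu]
  have hdist : ∀ t ∈ Metric.sphere (0 : ℂ) r, 2 * δ / 3 ≤ ‖gu.eval t - gu.eval 0‖ := by
    intro t ht
    have h1 := hus t ht
    have h2 := norm_sub_norm_le (gu.eval t) (gu.eval 0)
    rw [← hgu] at h1
    rw [← hgu0] at huc
    linarith
  have hfreq : ∃ᶠ t in 𝓝 (0 : ℂ), gu.eval t ≠ gu.eval 0 := by
    intro hev
    have hev' : ∀ᶠ t in 𝓝 (0 : ℂ), (gu - Polynomial.C (gu.eval 0)).eval t = 0 := by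
      filter_upwards [hev] with t ht
      simpa [sub_eq_zero] using ht
    have hzero : gu - Polynomial.C (gu.eval 0) = 0 :=
      Polynomial.eq_zero_of_infinite_isRoot _ (infinite_of_mem_nhds _ hev')
    obtain ⟨t, ht⟩ := NormedSpace.sphere_nonempty (E := ℂ) (x := 0).2 hr.le
    have h1 := hdist t ht
    have h2 := congrArg (Polynomial.eval t) hzero
    simp only [Polynomial.eval_sub, Polynomial.eval_C, Polynomial.eval_zero] at h2
    rw [h2, norm_zero] at h1
    linarith
  have himg := DiffContOnCl.ball_subset_image_closedBall
    (gu.differentiable.diffContOnCl (s := Metric.ball 0 r)) hr hdist hfreq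
  obtain ⟨t, ht, hzt⟩ := himg (show (0 : ℂ) ∈ _ by
    rw [Metric.mem_ball, dist_zero_left, hgu0]
    linarith)
  exact ⟨t, hVW huV (hball ht).1, by rw [← hgu]; exact hzt⟩

end evalAt

theorem MvPolynomial.eq_zero_of_eventually_eval_eq_zero {σ : Type*} [Finite σ]
    {q : MvPolynomial σ ℂ} {y : σ → ℂ} (hq : ∀ᶠ u in 𝓝 y, MvPolynomial.eval u q = 0) : q = 0 := by
  rw [Filter.Eventually, nhds_pi, Filter.mem_pi'] at hq
  obtain ⟨I, t, ht, hsub⟩ := hq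
  refine MvPolynomial.funext_set t (fun i => infinite_of_mem_nhds _ (ht i)) fun x hx => ?_
  rw [map_zero]
  exact hsub fun i _ => hx i trivial

theorem IsTranscendenceBasis.exists_ker_eval₂RingHom_eq_span {k : Type*} [Field k]
    {σ B : Type*} [Finite σ] [CommRing B] [IsDomain B] [Algebra k B] {f : σ → B} (hf : IsTranscendenceBasis k f) {s : B}
    (hs : s ≠ 0) :
    ∃ h : Polynomial (MvPolynomial σ k), h.coeff 0 ≠ 0 ∧
      RingHom.ker (Polynomial.eval₂RingHom (MvPolynomial.aeval (R := k) f).toRingHom s) =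
        Ideal.span {h} := by
  have hinj : Function.Injective (MvPolynomial.aeval f : MvPolynomial σ k →ₐ[k] B) :=
    hf.1
  refine Polynomial.exists_prime_ker_eq_span _ ?_ ?_ (by simpa using hs)
  · intro a b hab
    exact hinj (by simpa using hab)
  · have := hf.isAlgebraic
    obtain ⟨p, hp0, hp⟩ := Algebra.IsAlgebraic.isAlgebraic
      (R := Algebra.adjoin k (Set.range f)) s
    let e := hf.1.aevalEquiv
    rw [Ne, Submodule.eq_bot_iff]
    intro hbot
    refine hp0 ((Polynomial.map_eq_zero_iff e.symm.injective (f := e.symm.toRingHom)).1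
      (hbot _ ?_))
    have hcomp : (MvPolynomial.aeval f : MvPolynomial σ k →ₐ[k] B).toRingHom.comp e.symm.toRingHom =
        algebraMap (Algebra.adjoin k (Set.range f)) B := by
      ext a
      obtain ⟨b, rfl⟩ := e.surjective a
      simp [e]
    rw [RingHom.mem_ker, Polynomial.coe_eval₂RingHom, Polynomial.eval₂_map]
    rw [hcomp]
    exact hp

/-- If `B` has transcendence degree `n`, then the image of `Spec B` under `n + 1` elements of `B`,
of which the first `n` are algebraically independent, is dense in a hypersurface `h = 0` near the
points at which the last coordinate vanishes. -/
theorem exists_polynomial_dense_algHom.{u} {σ B : Type u} [Finite σ] [CommRing B] [IsDomain B]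
    [Algebra ℂ B] [Algebra.FiniteType ℂ B] (htr : Algebra.trdeg ℂ B ≤ Cardinal.mk σ)
    {f : σ → B} (hf : AlgebraicIndependent ℂ f) {s : B} (hs : s ≠ 0) :
    ∃ h : Polynomial (MvPolynomial σ ℂ), h.coeff 0 ≠ 0 ∧
      h.eval₂ (MvPolynomial.aeval (R := ℂ) f).toRingHom s = 0 ∧
      ∀ y, MvPolynomial.eval y (h.coeff 0) = 0 → ∀ U ∈ 𝓝 (y, (0 : ℂ)),
        ∃ χ : B →ₐ[ℂ] ℂ, ((fun j => χ (f j)), χ s) ∈ U := by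
  obtain ⟨h, hh0, hker⟩ :=
    (hf.isTranscendenceBasis_of_trdeg_le_of_finite htr).exists_ker_eval₂RingHom_eq_span hs
  set Φ := Polynomial.eval₂RingHom (MvPolynomial.aeval (R := ℂ) f).toRingHom s with hΦ
  have hΦh : Φ h = 0 := by
    rw [← RingHom.mem_ker, hker]
    exact Ideal.mem_span_singleton_self h
  refine ⟨h, hh0, hΦh, fun y hy U hU => ?_⟩
  rw [← evalAt_zero] at hy
  obtain ⟨t₁, c, ht₁⟩ : ∃ (t₁ : ℂ) (c : σ → ℂ), evalAt (y + t₁ • c, t₁) h ≠ 0 := by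
    have hne : Polynomial.X * h ≠ 0 :=
      mul_ne_zero Polynomial.X_ne_zero (fun h' => hh0 (by simp [h']))
    obtain ⟨⟨z, t⟩, hzt⟩ := exists_evalAt_ne_zero hne
    rw [map_mul, evalAt_X] at hzt
    have ht : t ≠ 0 := left_ne_zero_of_mul hzt
    refine ⟨t, t⁻¹ • (z - y), ?_⟩
    rw [smul_inv_smul₀ ht, add_sub_cancel]
    exact right_ne_zero_of_mul hzt
  have hzero := eventually_exists_evalAt_eq_zero hy ht₁ hU
  let w : σ → Polynomial (MvPolynomial σ ℂ) := fun j =>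
    Polynomial.C (MvPolynomial.X j) - Polynomial.C (MvPolynomial.C (c j)) * Polynomial.X
  let v : σ → B := fun j => Φ (w j)
  have hv : ∀ q, Φ (MvPolynomial.aeval (R := ℂ) w q) = MvPolynomial.aeval v q := by
    intro q
    have : Φ.comp (MvPolynomial.aeval (R := ℂ) w).toRingHom =
        (MvPolynomial.aeval v : MvPolynomial σ ℂ →ₐ[ℂ] B).toRingHom := by
      ext x
      · simp [Φ]
      · simp [v]
    exact congrArg (fun g : MvPolynomial σ ℂ →+* B => g q) this
  have hev : ∀ u t q, evalAt (u + t • c, t) (MvPolynomial.aeval (R := ℂ) w q) =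
      MvPolynomial.eval u q := by
    intro u t q
    have : (evalAt (u + t • c, t)).comp (MvPolynomial.aeval (R := ℂ) w).toRingHom =
        MvPolynomial.eval u := by
      ext x
      · simp
      · simp [w, mul_comm t]
    exact congrArg (fun g : MvPolynomial σ ℂ →+* ℂ => g q) this
  have hker_evalAt : ∀ {p}, evalAt p h = 0 → RingHom.ker Φ ≤ RingHom.ker (evalAt p) := by
    intro p hp
    rw [hker, Ideal.span_singleton_le_iff_mem]
    exact hp
  have hvind : AlgebraicIndependent ℂ v := by
    rw [algebraicIndependent_iff]
    intro q hq
    refine MvPolynomial.eq_zero_of_eventually_eval_eq_zero (y := y) ?_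
    filter_upwards [hzero] with u hu
    obtain ⟨t, -, ht⟩ := hu
    rw [← hev u t q]
    exact hker_evalAt ht ((hv q).trans hq)
  have halg := (hvind.isTranscendenceBasis_of_trdeg_le_of_finite htr).isAlgebraic
  have hft : Algebra.FiniteType (Algebra.adjoin ℂ (Set.range v)) B :=
    Algebra.FiniteType.of_restrictScalars_finiteType ℂ _ _
  obtain ⟨d, hd0, hd⟩ :=
    Algebra.IsAlgebraic.exists_pow_smul_isIntegral (Algebra.adjoin ℂ (Set.range v)) B
  let e := hvind.aevalEquiv
  obtain ⟨D, rfl⟩ := e.surjective d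
  have hD0 : D ≠ 0 := fun h0 => hd0 (by rw [h0, map_zero])
  obtain ⟨u, ⟨t, htU, ht⟩, hDu⟩ : ∃ u, (∃ t, (u + t • c, t) ∈ U ∧
      evalAt (u + t • c, t) h = 0) ∧ MvPolynomial.eval u D ≠ 0 := by
    by_contra! hcon
    exact hD0 (MvPolynomial.eq_zero_of_eventually_eval_eq_zero (hzero.mono hcon))
  let _ : Algebra (Polynomial (MvPolynomial σ ℂ)) B := Φ.toAlgebra
  have hd' : ∀ b : B, ∃ N : ℕ, IsIntegral (Polynomial (MvPolynomial σ ℂ))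
      ((MvPolynomial.aeval (R := ℂ) w D : Polynomial (MvPolynomial σ ℂ)) ^ N • b) := by
    intro b
    obtain ⟨N, hN⟩ := hd b
    refine ⟨N, ?_⟩
    have h1 : (MvPolynomial.aeval (R := ℂ) w D : Polynomial (MvPolynomial σ ℂ)) ^ N • b =
        e D ^ N • b := by
      rw [Algebra.smul_def, Algebra.smul_def, map_pow, map_pow]
      congr 2
      exact (hv D).trans (by simp [e])
    rw [h1]
    refine hN.map_of_comp_eq ((MvPolynomial.aeval (R := ℂ) w).toRingHom.comp e.symm.toRingHom)
      (RingHom.id B) ?_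
    ext a
    obtain ⟨b, rfl⟩ := e.surjective a
    refine Eq.trans (b := Φ (MvPolynomial.aeval (R := ℂ) w b)) (by simp; rfl) ?_
    rw [hv]
    simp [e]
  have hprime : (RingHom.ker (evalAt (u + t • c, t))).IsPrime := RingHom.ker_isPrime _
  have htop := Ideal.map_ne_top_of_pow_smul_isIntegral hd' (hker_evalAt ht)
    (by rwa [RingHom.mem_ker, hev])
  obtain ⟨χ, hχ⟩ := Ideal.exists_algHom_le_ker (k := ℂ) htop
  have hχΦ : ∀ p, χ (Φ p) = evalAt (u + t • c, t) p := by
    intro p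
    have hmem : p - Polynomial.C (MvPolynomial.C (evalAt (u + t • c, t) p)) ∈
        RingHom.ker (evalAt (u + t • c, t)) := by
      simp [RingHom.mem_ker]
    have := hχ _ (Ideal.mem_map_of_mem (algebraMap _ B) hmem)
    change χ (Φ _) = 0 at this
    rw [map_sub, map_sub, sub_eq_zero] at this
    rw [this]
    simp [Φ]
  refine ⟨χ, ?_⟩
  convert htU using 2
  · ext j
    have := hχΦ (Polynomial.C (MvPolynomial.X j))
    simpa [Φ] using this
  · have := hχΦ Polynomial.X
    simpa [Φ] using this

theorem Localization.trdeg_le_of_le_nonZeroDivisors (n : ℕ)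
    (M : Submonoid (MvPolynomial (Fin n) ℂ))
    (hM : M ≤ nonZeroDivisors _) : Algebra.trdeg ℂ (Localization M) ≤ Cardinal.mk (Fin n) := by
  have : IsDomain (Localization M) := IsLocalization.isDomain_localization hM
  have : FaithfulSMul (MvPolynomial (Fin n) ℂ) (Localization M) :=
    (faithfulSMul_iff_algebraMap_injective _ _).2 (IsLocalization.injective _ hM)
  have : Algebra.IsAlgebraic (MvPolynomial (Fin n) ℂ) (Localization M) :=
    IsLocalization.isAlgebraic _ M
  rw [← trdeg_add_eq ℂ (MvPolynomial (Fin n) ℂ) (A := Localization M),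
    MvPolynomial.trdeg_of_isDomain, trdeg_eq_zero]
  simp

theorem algebraicIndependent_of_dense_range {n : ℕ} {P : Fin n → MvPolynomial (Fin n) ℂ}
    {F : (Fin n → ℂ) → (Fin n → ℂ)} (hF : ∀ x i, F x i = MvPolynomial.eval x (P i))
    (hdom : Dense (Set.range F)) : AlgebraicIndependent ℂ P := by
  rw [algebraicIndependent_iff]
  intro q hq
  have h0 : ∀ z ∈ Set.range F, MvPolynomial.eval z q = 0 := by
    rintro _ ⟨x, rfl⟩
    have : (MvPolynomial.eval x).comp (MvPolynomial.aeval (R := ℂ) P).toRingHom =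
        MvPolynomial.eval (F x) := by
      ext i
      · simp
      · simp [hF]
    rw [← this]
    simpa using congrArg (MvPolynomial.eval x) hq
  refine MvPolynomial.funext fun z => ?_
  rw [map_zero]
  exact congrFun ((MvPolynomial.continuous_eval q).ext_on hdom continuous_const h0) z

/-- The set of limits of `F` along sequences on which the `i`-th coordinate is unbounded is the zero
set of the leading coefficient of an algebraic relation between `F` and that coordinate. -/
theorem exists_polynomial_coordinate {n : ℕ} {P : Fin n → MvPolynomial (Fin n) ℂ}
    {F : (Fin n → ℂ) → (Fin n → ℂ)} (hF : ∀ x i, F x i = MvPolynomial.eval x (P i))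
    (hdom : Dense (Set.range F)) (i : Fin n) :
    ∃ Q : MvPolynomial (Fin n) ℂ, Q ≠ 0 ∧
      (∀ y, MvPolynomial.eval y Q ≠ 0 → ∃ C : ℝ, ∀ᶠ z in 𝓝 y, ∀ ξ, F ξ = z → ‖ξ i‖ ≤ C) ∧
      ∀ y, MvPolynomial.eval y Q = 0 → ∀ V ∈ 𝓝 y, ∀ C : ℝ, ∃ ξ, F ξ ∈ V ∧ C ≤ ‖ξ i‖ := by
  let R := MvPolynomial (Fin n) ℂ
  let x : R := MvPolynomial.X i
  have hx : x ≠ 0 := MvPolynomial.X_ne_zero i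
  have hM : Submonoid.powers x ≤ nonZeroDivisors R :=
    powers_le_nonZeroDivisors_of_noZeroDivisors hx
  let B := Localization.Away x
  have hB : IsDomain B := IsLocalization.isDomain_localization hM
  have hinj : Function.Injective (algebraMap R B) := IsLocalization.injective _ hM
  have hft : Algebra.FiniteType R B := IsLocalization.finiteType_of_monoid_fg (Submonoid.powers x) B
  have hft' : Algebra.FiniteType ℂ B := Algebra.FiniteType.trans (S := R) inferInstance hft
  let f : Fin n → B := fun j => algebraMap R B (P j)
  have hf : AlgebraicIndependent ℂ f :=
    (algebraicIndependent_of_dense_range hF hdom).map' (f := IsScalarTower.toAlgHom ℂ R B) hinj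
  let s : B := IsLocalization.Away.invSelf x
  have hxs : algebraMap R B x * s = 1 := IsLocalization.Away.mul_invSelf x
  obtain ⟨h, hh0, hhs, hh⟩ := exists_polynomial_dense_algHom
    (Localization.trdeg_le_of_le_nonZeroDivisors n _ hM) hf (right_ne_zero_of_mul_eq_one hxs)
  have hrel : ∀ ξ, ξ i ≠ 0 → evalAt (F ξ, (ξ i)⁻¹) h = 0 := by
    intro ξ hξ
    have hu : IsUnit (MvPolynomial.eval ξ x) := by simpa [x] using hξ
    let χ : B →+* ℂ := IsLocalization.Away.lift x hu
    have hχ : ∀ p : R, χ (algebraMap R B p) = MvPolynomial.eval ξ p :=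
      IsLocalization.Away.lift_eq x hu
    have hχs : χ s = (ξ i)⁻¹ := by
      have := congrArg χ hxs
      rw [map_mul, hχ, map_one] at this
      exact eq_inv_of_mul_eq_one_right (by simpa [x] using this)
    have hcomp : χ.comp (Polynomial.eval₂RingHom (MvPolynomial.aeval (R := ℂ) f).toRingHom s) =
        evalAt (F ξ, (ξ i)⁻¹) := by
      ext j
      · simp only [RingHom.comp_apply, Polynomial.coe_eval₂RingHom, Polynomial.eval₂_C, evalAt_C,
          MvPolynomial.eval_C]
        have := hχ (MvPolynomial.C j)
        rw [MvPolynomial.eval_C] at this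
        refine Eq.trans (congrArg χ ?_) this
        exact (MvPolynomial.aeval_C f j).trans (IsScalarTower.algebraMap_apply ℂ R B j)
      · simp [f, hχ, hF]
      · simp [hχs]
    rw [← hcomp, RingHom.comp_apply, Polynomial.coe_eval₂RingHom, hhs, map_zero]
  refine ⟨h.coeff 0, hh0, fun y hy => ?_, fun y hy V hV C => ?_⟩
  · rw [← evalAt_zero] at hy
    have hev := (continuous_evalAt h).continuousAt.eventually_ne hy
    rw [nhds_prod_eq] at hev
    obtain ⟨V, hV, W, hW, hVW⟩ := eventually_prod_iff.1 hev
    obtain ⟨ε, hε, hball⟩ := Metric.eventually_nhds_iff.1 hW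
    refine ⟨ε⁻¹, hV.mono ?_⟩
    rintro _ hz ξ rfl
    by_contra! hlt
    have hpos : 0 < ‖ξ i‖ := (inv_pos.2 hε).trans hlt
    refine hVW hz (hball ?_) (hrel ξ (norm_pos_iff.1 hpos))
    rw [dist_zero_right, norm_inv]
    exact inv_lt_of_inv_lt₀ hε hlt
  · have hC : 0 < max C 1 := lt_max_of_lt_right one_pos
    obtain ⟨χ, hχ⟩ := hh y hy (V ×ˢ Metric.ball 0 (max C 1)⁻¹)
      (prod_mem_nhds hV (Metric.ball_mem_nhds _ (inv_pos.2 hC)))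
    let ξ : Fin n → ℂ := fun j => χ (algebraMap R B (MvPolynomial.X j))
    have hξ : ∀ p : R, χ (algebraMap R B p) = MvPolynomial.eval ξ p := by
      intro p
      have : χ.comp (IsScalarTower.toAlgHom ℂ R B) = MvPolynomial.aeval ξ := by
        ext j
        simp only [AlgHom.comp_apply, MvPolynomial.aeval_X, ξ]
        rfl
      exact congrArg (fun g : R →ₐ[ℂ] ℂ => g p) this
    have hFξ : F ξ = fun j => χ (f j) := by
      ext j
      rw [hF, hξ]
    refine ⟨ξ, hFξ ▸ hχ.1, ?_⟩
    have hs := hχ.2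
    rw [mem_ball_zero_iff] at hs
    have hmul := congrArg χ hxs
    rw [map_mul, map_one] at hmul
    change ξ i * χ s = 1 at hmul
    rw [eq_inv_of_mul_eq_one_right hmul, norm_inv] at hs
    have hpos : 0 < ‖ξ i‖ := norm_pos_iff.2 (left_ne_zero_of_mul_eq_one hmul)
    exact (le_max_left C 1).trans ((inv_lt_inv₀ hpos hC).1 hs).le

/-- (Jelonek) For a dominant polynomial mapping `F : ℂⁿ → ℂⁿ`, the asymptotic set `S_F` is
either empty or a hypersurface: if nonempty, it is the zero set of a nonconstant polynomial. -/
theorem asymptoticSet_empty_or_hypersurface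
    (n : ℕ) (P : Fin n → MvPolynomial (Fin n) ℂ)
    (F : (Fin n → ℂ) → (Fin n → ℂ))
    (hF : ∀ x i, F x i = MvPolynomial.eval x (P i))
    (hdom : Dense (Set.range F))
    (hne : asymptoticSet F ≠ ∅) :
    ∃ Q : MvPolynomial (Fin n) ℂ, 0 < Q.totalDegree ∧
      asymptoticSet F = {x | MvPolynomial.eval x Q = 0} := by
  choose Q hQ0 hbdd hunbdd using exists_polynomial_coordinate hF hdom
  have hprod : (∏ i, Q i) ≠ 0 := Finset.prod_ne_zero_iff.2 fun i _ => hQ0 i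
  have hS : asymptoticSet F = {x | MvPolynomial.eval x (∏ i, Q i) = 0} := by
    ext y
    rw [Set.mem_ofPred_eq, map_prod, Finset.prod_eq_zero_iff]
    constructor
    · rintro ⟨ξ, hξ, hlim⟩
      by_contra! hcon
      choose C hC using fun i => hbdd i y (hcon i (Finset.mem_univ i))
      have hb : ∀ᶠ k in atTop, ∀ i, ‖ξ k i‖ ≤ C i := by
        rw [eventually_all]
        intro i
        filter_upwards [hlim.eventually (hC i)] with k hk
        exact hk _ rfl
      have hC' : ∀ᶠ k in atTop, ‖ξ k‖ ≤ ∑ i, |C i| := by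
        filter_upwards [hb] with k hk
        refine (pi_norm_le_iff_of_nonneg (Finset.sum_nonneg fun i _ => abs_nonneg _)).2 fun i => ?_
        exact (hk i).trans ((le_abs_self _).trans
          (Finset.single_le_sum (f := fun i => |C i|) (fun i _ => abs_nonneg _)
            (Finset.mem_univ i)))
      obtain ⟨k, hk, hk'⟩ := (hC'.and (hξ.eventually_gt_atTop (∑ i, |C i|))).exists
      exact absurd hk hk'.not_ge
    · rintro ⟨i, -, hi⟩
      choose ξ hξ hξi using fun k : ℕ =>
        hunbdd i y hi (Metric.ball y (1 / ((k : ℝ) + 1)))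
          (Metric.ball_mem_nhds _ Nat.one_div_pos_of_nat) k
      refine ⟨ξ, tendsto_atTop_mono (fun k => (hξi k).trans (norm_le_pi_norm _ i))
        tendsto_natCast_atTop_atTop, ?_⟩
      rw [tendsto_iff_dist_tendsto_zero]
      exact squeeze_zero (fun _ => dist_nonneg) (fun k => (hξ k).le)
        tendsto_one_div_add_atTop_nhds_zero_nat
  refine ⟨∏ i, Q i, Nat.pos_of_ne_zero fun hdeg => ?_, hS⟩
  obtain ⟨y, hy⟩ := Set.nonempty_iff_ne_empty.2 hne
  rw [hS, Set.mem_ofPred_eq] at hy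
  rw [MvPolynomial.totalDegree_eq_zero_iff_eq_C.1 hdeg, MvPolynomial.eval_C] at hy
  rw [MvPolynomial.totalDegree_eq_zero_iff_eq_C.1 hdeg, hy, map_zero] at hprod
  exact hprod rfl
end

section
/- There exists a dominant polynomial mapping F : ℂ³ → ℂ³ of degree 2 whose asymptotic set S_F is a plane. -/
open Filter Topology

/-- A plane in `ℂ³`: the zero set of a polynomial of total degree 1. -/
def IsPlane (S : Set (Fin 3 → ℂ)) : Prop :=
  ∃ Q : MvPolynomial (Fin 3) ℂ, Q.totalDegree = 1 ∧
    S = {x | MvPolynomial.eval x Q = 0}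

/-- A paraboloid in `ℂ³`: the zero set of a polynomial of the form
`r·x_i² + s·x_j + t·x_l + u` where `{i, j, l} = {1, 2, 3}`, `r ≠ 0` and `(s, t) ≠ (0, 0)`. -/
def IsParaboloid (S : Set (Fin 3 → ℂ)) : Prop :=
  ∃ (i j l : Fin 3) (r s t u : ℂ),
    i ≠ j ∧ j ≠ l ∧ i ≠ l ∧ r ≠ 0 ∧ (s, t) ≠ (0, 0) ∧
    S = {x | r * (x i) ^ 2 + s * x j + t * x l + u = 0}

/-- `F : ℂ³ → ℂ³` is a polynomial mapping of degree 2 with coordinate polynomials `P`. -/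
def IsDegTwoPolyMap (P : Fin 3 → MvPolynomial (Fin 3) ℂ)
    (F : (Fin 3 → ℂ) → (Fin 3 → ℂ)) : Prop :=
  (∀ x i, F x i = MvPolynomial.eval x (P i)) ∧
  (∀ i, (P i).totalDegree ≤ 2) ∧ (∃ i, (P i).totalDegree = 2)

open MvPolynomial in
/-- The polynomials defining the mapping `(x, y, z) ↦ (x, x * y, z)`. -/
noncomputable def shearPoly : Fin 3 → MvPolynomial (Fin 3) ℂ :=
  ![X 0, X 0 * X 1, X 2]

/-- The mapping `(x, y, z) ↦ (x, x * y, z)`. -/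
def shearMap (v : Fin 3 → ℂ) : Fin 3 → ℂ :=
  ![v 0, v 0 * v 1, v 2]

theorem isDegTwoPolyMap_shearMap : IsDegTwoPolyMap shearPoly shearMap := by
  have h : (MvPolynomial.X 0 * MvPolynomial.X 1 : MvPolynomial (Fin 3) ℂ).totalDegree = 2 := by
    rw [MvPolynomial.totalDegree_mul_of_isDomain (MvPolynomial.X_ne_zero _)
      (MvPolynomial.X_ne_zero _)]
    simp
  refine ⟨fun x i => ?_, fun i => ?_, 1, h⟩
  · fin_cases i <;> simp [shearMap, shearPoly]
  · fin_cases i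
    · simp [shearPoly]
    · exact h.le
    · simp [shearPoly]

theorem mem_asymptoticSet_shearMap {a : Fin 3 → ℂ} (ha : a 0 = 0) :
    a ∈ asymptoticSet shearMap := by
  refine ⟨fun k => ![a 1 / ((k : ℂ) + 1), (k : ℂ) + 1, a 2], ?_, ?_⟩
  · refine tendsto_atTop_mono (fun k => ?_) tendsto_natCast_atTop_atTop
    refine le_trans ?_ (norm_le_pi_norm _ 1)
    have hk : ‖((k : ℂ) + 1)‖ = (k : ℝ) + 1 := by
      exact_mod_cast Complex.norm_natCast (k + 1)
    simp [hk]
  · rw [tendsto_pi_nhds]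
    intro i
    fin_cases i
    · have h := (tendsto_one_div_add_atTop_nhds_zero_nat (𝕜 := ℂ)).const_mul (a 1)
      simpa [shearMap, ha, div_eq_mul_inv] using h
    · refine tendsto_const_nhds.congr fun k => ?_
      have hk : (k : ℂ) + 1 ≠ 0 := Nat.cast_add_one_ne_zero k
      simp [shearMap, hk]
    · simp [shearMap]

/-- Off the plane `x = 0`, `shearMap` has a continuous left inverse, so it is proper there. -/
theorem apply_zero_of_mem_asymptoticSet_shearMap {a : Fin 3 → ℂ}
    (ha : a ∈ asymptoticSet shearMap) : a 0 = 0 := by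
  obtain ⟨ξ, hξ, hF⟩ := ha
  by_contra h0
  have hc (i : Fin 3) : Tendsto (fun k => shearMap (ξ k) i) atTop (𝓝 (a i)) :=
    tendsto_pi_nhds.1 hF i
  have hx : Tendsto (fun k => ξ k 0) atTop (𝓝 (a 0)) := hc 0
  have hlim : Tendsto ξ atTop (𝓝 ![a 0, a 1 / a 0, a 2]) := by
    rw [tendsto_pi_nhds]
    intro i
    fin_cases i
    · exact hx
    · refine ((hc 1).div hx h0).congr' ?_
      filter_upwards [hx.eventually_ne h0] with k hk
      simp [shearMap, hk]
    · exact hc 2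
  exact not_tendsto_nhds_of_tendsto_atTop hξ _ hlim.norm

theorem asymptoticSet_shearMap : asymptoticSet shearMap = {a | a 0 = 0} :=
  Set.ext fun _ => ⟨apply_zero_of_mem_asymptoticSet_shearMap, mem_asymptoticSet_shearMap⟩

theorem dense_range_shearMap : Dense (Set.range shearMap) := by
  intro a
  by_cases ha : a 0 = 0
  · obtain ⟨ξ, -, hF⟩ := mem_asymptoticSet_shearMap ha
    exact mem_closure_of_tendsto hF (Eventually.of_forall fun k => Set.mem_range_self (ξ k))
  · refine subset_closure ⟨![a 0, a 1 / a 0, a 2], ?_⟩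
    ext i
    fin_cases i
    · rfl
    · simp [shearMap, mul_div_cancel₀, ha]
    · rfl

/-- There is a dominant polynomial mapping `F : ℂ³ → ℂ³` of degree 2 whose asymptotic set
is a plane. -/
theorem exists_asymptoticSet_plane :
    ∃ (P : Fin 3 → MvPolynomial (Fin 3) ℂ) (F : (Fin 3 → ℂ) → (Fin 3 → ℂ)),
      IsDegTwoPolyMap P F ∧ Dense (Set.range F) ∧ IsPlane (asymptoticSet F) := by
  refine ⟨shearPoly, shearMap, isDegTwoPolyMap_shearMap, dense_range_shearMap,
    MvPolynomial.X 0, by simp, ?_⟩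
  simp [asymptoticSet_shearMap]
end

section
/- There exists a dominant polynomial mapping F : ℂ³ → ℂ³ of degree 2 whose asymptotic set S_F is a paraboloid. -/
open Filter Topology

/-- The map `(x, y, z) ↦ (x, y + x², y z)`. -/
noncomputable def paraboloidPoly : Fin 3 → MvPolynomial (Fin 3) ℂ :=
  ![MvPolynomial.X 0, MvPolynomial.X 1 + MvPolynomial.X 0 ^ 2,
    MvPolynomial.X 1 * MvPolynomial.X 2]

/-- The polynomial mapping with coordinates `paraboloidPoly`. -/
def paraboloidMap (x : Fin 3 → ℂ) : Fin 3 → ℂ := ![x 0, x 1 + x 0 ^ 2, x 1 * x 2]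

theorem isDegTwoPolyMap_paraboloidMap : IsDegTwoPolyMap paraboloidPoly paraboloidMap := by
  have h2 : (paraboloidPoly 2).totalDegree = 2 := by
    change (MvPolynomial.X 1 * MvPolynomial.X 2 : MvPolynomial (Fin 3) ℂ).totalDegree = 2
    rw [MvPolynomial.totalDegree_mul_of_isDomain (MvPolynomial.X_ne_zero _)
      (MvPolynomial.X_ne_zero _)]
    simp
  refine ⟨fun x i => ?_, fun i => ?_, 2, h2⟩
  · fin_cases i <;> simp [paraboloidMap, paraboloidPoly]
  · fin_cases i
    · simp [paraboloidPoly]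
    · refine (MvPolynomial.totalDegree_add _ _).trans ?_
      simp
    · exact h2.le

theorem mem_asymptoticSet_paraboloidMap {a : Fin 3 → ℂ} (ha : a 1 = a 0 ^ 2) :
    a ∈ asymptoticSet paraboloidMap := by
  refine ⟨fun k => ![a 0, a 2 / ((k : ℂ) + 1), (k : ℂ) + 1], ?_, ?_⟩
  · refine tendsto_atTop_mono (fun k => ?_)
      (tendsto_atTop_add_const_right _ (1 : ℝ) (tendsto_natCast_atTop_atTop (R := ℝ)))
    refine le_trans (le_of_eq ?_) (norm_le_pi_norm _ (2 : Fin 3))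
    have h : ‖((k + 1 : ℕ) : ℂ)‖ = ((k + 1 : ℕ) : ℝ) := Complex.norm_natCast _
    push_cast at h
    simpa using h.symm
  · have hk : ∀ k : ℕ, (k : ℂ) + 1 ≠ 0 := fun k => Nat.cast_add_one_ne_zero k
    have h0 : Tendsto (fun k : ℕ => a 2 * (1 / ((k : ℂ) + 1)) + a 0 ^ 2) atTop (𝓝 (a 1)) := by
      simpa [ha] using
        ((tendsto_one_div_add_atTop_nhds_zero_nat (𝕜 := ℂ)).const_mul (a 2)).add_const (a 0 ^ 2)
    rw [tendsto_pi_nhds]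
    intro i
    fin_cases i
    · simp [paraboloidMap]
    · simpa [paraboloidMap, div_eq_mul_inv] using h0
    · simp [paraboloidMap, hk]

theorem asymptoticSet_paraboloidMap :
    asymptoticSet paraboloidMap = {a | a 1 = a 0 ^ 2} := by
  refine Set.Subset.antisymm ?_ fun a ha => mem_asymptoticSet_paraboloidMap ha
  rintro a ⟨ξ, hξ, hF⟩
  by_contra hne
  rw [tendsto_pi_nhds] at hF
  have hx : Tendsto (fun k => ξ k 0) atTop (𝓝 (a 0)) := by
    simpa [paraboloidMap] using hF 0
  have hy : Tendsto (fun k => ξ k 1) atTop (𝓝 (a 1 - a 0 ^ 2)) := by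
    simpa [paraboloidMap] using (hF 1).sub (hx.pow 2)
  have hd : a 1 - a 0 ^ 2 ≠ 0 := sub_ne_zero.mpr hne
  have hz : Tendsto (fun k => ξ k 2) atTop (𝓝 (a 2 / (a 1 - a 0 ^ 2))) := by
    refine ((hF 2).div hy hd).congr' ?_
    filter_upwards [hy.eventually_ne hd] with k hk
    simp [paraboloidMap, hk]
  have hlim : Tendsto ξ atTop (𝓝 ![a 0, a 1 - a 0 ^ 2, a 2 / (a 1 - a 0 ^ 2)]) := by
    rw [tendsto_pi_nhds]
    intro i
    fin_cases i
    · exact hx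
    · exact hy
    · exact hz
  exact not_tendsto_atTop_of_tendsto_nhds hlim.norm hξ

theorem dense_range_paraboloidMap : Dense (Set.range paraboloidMap) := by
  intro a
  by_cases ha : a 1 = a 0 ^ 2
  · obtain ⟨ξ, -, hF⟩ := mem_asymptoticSet_paraboloidMap ha
    exact mem_closure_of_tendsto hF (Eventually.of_forall fun k => Set.mem_range_self _)
  · refine subset_closure ⟨![a 0, a 1 - a 0 ^ 2, a 2 / (a 1 - a 0 ^ 2)], ?_⟩
    have hd : a 1 - a 0 ^ 2 ≠ 0 := sub_ne_zero.mpr ha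
    ext i
    fin_cases i
    · simp [paraboloidMap]
    · simp [paraboloidMap]
    · simp [paraboloidMap, mul_div_cancel₀, hd]

/-- There is a dominant polynomial mapping `F : ℂ³ → ℂ³` of degree 2 whose asymptotic set
is a paraboloid. -/
theorem exists_asymptoticSet_paraboloid :
    ∃ (P : Fin 3 → MvPolynomial (Fin 3) ℂ) (F : (Fin 3 → ℂ) → (Fin 3 → ℂ)),
      IsDegTwoPolyMap P F ∧ Dense (Set.range F) ∧ IsParaboloid (asymptoticSet F) := by
  refine ⟨paraboloidPoly, paraboloidMap, isDegTwoPolyMap_paraboloidMap,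
    dense_range_paraboloidMap, 0, 1, 2, 1, -1, 0, 0, by decide, by decide, by decide,
    one_ne_zero, by simp, ?_⟩
  rw [asymptoticSet_paraboloidMap]
  ext a
  simp only [Set.mem_ofPred_eq]
  constructor <;> intro h <;> linear_combination -h
end

section
/- There exists a dominant polynomial mapping F : ℂ³ → ℂ³ of degree 2 whose asymptotic set S_F is the union of two distinct planes. -/
open Filter Topology

theorem dense_setOf_forall_ne_zero {ι : Type*} : Dense {a : ι → ℂ | ∀ i, a i ≠ 0} := by
  have h := dense_pi (Set.univ : Set ι) (s := fun _ => ({0}ᶜ : Set ℂ))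
    fun _ _ => dense_compl_singleton 0
  convert h using 1
  ext a
  simp [Set.mem_pi]

/-- The map `(x, y, z) ↦ (x, xy, yz)`. -/
def chainProductMap (x : Fin 3 → ℂ) : Fin 3 → ℂ := ![x 0, x 0 * x 1, x 1 * x 2]

theorem dense_range_chainProductMap : Dense (Set.range chainProductMap) := by
  refine dense_setOf_forall_ne_zero.mono fun a ha => ?_
  have h0 := ha 0
  have h1 := ha 1
  refine ⟨![a 0, a 1 / a 0, a 2 * a 0 / a 1], ?_⟩
  ext i
  fin_cases i <;> simp [chainProductMap] <;> field_simp

theorem tendsto_norm_atTop_of_coord {ι α : Type*} [Fintype ι] {l : Filter α} {ξ : α → ι → ℂ}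
    (i : ι) (h : Tendsto (fun k => ‖ξ k i‖) l atTop) : Tendsto (fun k => ‖ξ k‖) l atTop :=
  tendsto_atTop_mono (fun k => norm_le_pi_norm (ξ k) i) h

theorem tendsto_inv_natCast_add_one :
    Tendsto (fun k : ℕ => ((k : ℂ) + 1)⁻¹) atTop (𝓝 0) := by
  simpa [one_div] using tendsto_one_div_add_atTop_nhds_zero_nat (𝕜 := ℂ)

theorem mem_asymptoticSet_chainProductMap_of_snd_eq_zero {a : Fin 3 → ℂ} (ha : a 1 = 0) :
    a ∈ asymptoticSet chainProductMap := by
  have hinv := tendsto_inv_natCast_add_one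
  have hne (k : ℕ) : (k : ℂ) + 1 ≠ 0 := Nat.cast_add_one_ne_zero k
  refine ⟨fun k => ![a 0, ((k : ℂ) + 1)⁻¹ ^ 2, ((k : ℂ) + 1) ^ 2 * a 2 + ((k : ℂ) + 1)],
    tendsto_norm_atTop_of_coord 2 ?_, ?_⟩
  · have hnorm : Tendsto (fun k : ℕ => ‖(k : ℂ) + 1‖) atTop atTop := by
      have h (k : ℕ) : ‖(k : ℂ) + 1‖ = (k : ℝ) + 1 := by
        exact_mod_cast Complex.norm_natCast (k + 1)
      simp only [h]
      exact tendsto_atTop_add_const_right _ _ tendsto_natCast_atTop_atTop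
    by_cases h2 : a 2 = 0
    · simpa [h2] using hnorm
    · have hlim : Tendsto (fun k : ℕ => ‖a 2 + ((k : ℂ) + 1)⁻¹‖) atTop (𝓝 ‖a 2‖) := by
        simpa using (hinv.const_add (a 2)).norm
      refine (((tendsto_pow_atTop two_ne_zero).comp hnorm).atTop_mul_pos
        (norm_pos_iff.mpr h2) hlim).congr fun k => ?_
      have := hne k
      simp only [Function.comp, ← norm_pow, ← norm_mul, Matrix.cons_val]
      congr 1
      field_simp
  · refine tendsto_pi_nhds.mpr fun i => ?_
    fin_cases i
    · simp [chainProductMap]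
    · simpa [chainProductMap, ha] using (hinv.pow 2).const_mul (a 0)
    · have h := hinv.const_add (a 2)
      rw [add_zero] at h
      refine h.congr fun k => ?_
      have := hne k
      simp only [chainProductMap, Fin.reduceFinMk, Matrix.cons_val]
      field_simp

theorem mem_asymptoticSet_chainProductMap_of_fst_eq_zero {a : Fin 3 → ℂ} (ha : a 0 = 0)
    (h1 : a 1 ≠ 0) : a ∈ asymptoticSet chainProductMap := by
  have hinv := tendsto_inv_natCast_add_one
  have hne (k : ℕ) : (k : ℂ) + 1 ≠ 0 := Nat.cast_add_one_ne_zero k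
  refine ⟨fun k => ![((k : ℂ) + 1)⁻¹, a 1 * ((k : ℂ) + 1), a 2 / (a 1 * ((k : ℂ) + 1))],
    tendsto_norm_atTop_of_coord 1 ?_, ?_⟩
  · have h (k : ℕ) : ‖a 1 * ((k : ℂ) + 1)‖ = ‖a 1‖ * ((k : ℝ) + 1) := by
      rw [norm_mul]
      congr 1
      exact_mod_cast Complex.norm_natCast (k + 1)
    simp only [Matrix.cons_val, h]
    exact (tendsto_atTop_add_const_right _ _ tendsto_natCast_atTop_atTop).const_mul_atTop
      (norm_pos_iff.mpr h1)
  · refine tendsto_pi_nhds.mpr fun i => ?_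
    fin_cases i
    · simpa [chainProductMap, ha] using hinv
    · refine tendsto_const_nhds.congr fun k => ?_
      have := hne k
      simp only [chainProductMap, Fin.mk_one, Matrix.cons_val]
      field_simp
    · refine tendsto_const_nhds.congr fun k => ?_
      have := hne k
      simp only [chainProductMap, Fin.reduceFinMk, Matrix.cons_val]
      field_simp

theorem asymptoticSet_chainProductMap :
    asymptoticSet chainProductMap = {a | a 0 = 0} ∪ {a | a 1 = 0} := by
  ext a
  constructor
  · rintro ⟨ξ, hξ, hF⟩
    by_contra hcon
    simp only [Set.mem_union, Set.mem_ofPred_eq, not_or] at hcon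
    obtain ⟨h0, h1⟩ := hcon
    rw [tendsto_pi_nhds] at hF
    have hx : Tendsto (fun k => ξ k 0) atTop (𝓝 (a 0)) := hF 0
    have hxy : Tendsto (fun k => ξ k 0 * ξ k 1) atTop (𝓝 (a 1)) := hF 1
    have hyz : Tendsto (fun k => ξ k 1 * ξ k 2) atTop (𝓝 (a 2)) := hF 2
    have hy : Tendsto (fun k => ξ k 1) atTop (𝓝 (a 1 / a 0)) := by
      refine (hxy.div hx h0).congr' ?_
      filter_upwards [hx.eventually_ne h0] with k hk
      exact mul_div_cancel_left₀ _ hk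
    have hz : Tendsto (fun k => ξ k 2) atTop (𝓝 (a 2 / (a 1 / a 0))) := by
      refine (hyz.div hy (div_ne_zero h1 h0)).congr' ?_
      filter_upwards [hy.eventually_ne (div_ne_zero h1 h0)] with k hk
      exact mul_div_cancel_left₀ _ hk
    have hlim : Tendsto ξ atTop (𝓝 ![a 0, a 1 / a 0, a 2 / (a 1 / a 0)]) := by
      refine tendsto_pi_nhds.mpr fun i => ?_
      fin_cases i
      exacts [hx, hy, hz]
    exact not_tendsto_nhds_of_tendsto_atTop hξ _ hlim.norm
  · intro ha
    by_cases h1 : a 1 = 0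
    · exact mem_asymptoticSet_chainProductMap_of_snd_eq_zero h1
    · exact mem_asymptoticSet_chainProductMap_of_fst_eq_zero (ha.resolve_right h1) h1

theorem isPlane_coord_eq_zero (i : Fin 3) : IsPlane {a | a i = 0} :=
  ⟨MvPolynomial.X i, MvPolynomial.totalDegree_X i, by simp⟩

theorem isDegTwoPolyMap_chainProductMap :
    IsDegTwoPolyMap
      ![MvPolynomial.X 0, MvPolynomial.X 0 * MvPolynomial.X 1,
        MvPolynomial.X 1 * MvPolynomial.X 2] chainProductMap := by
  have h (i j : Fin 3) :
      (MvPolynomial.X i * MvPolynomial.X j : MvPolynomial (Fin 3) ℂ).totalDegree = 2 := by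
    rw [MvPolynomial.totalDegree_mul_of_isDomain (MvPolynomial.X_ne_zero i)
      (MvPolynomial.X_ne_zero j), MvPolynomial.totalDegree_X, MvPolynomial.totalDegree_X]
  refine ⟨fun x i => ?_, fun i => ?_, 1, h 0 1⟩
  · fin_cases i <;> simp [chainProductMap]
  · fin_cases i
    · simp
    · exact (h 0 1).le
    · exact (h 1 2).le

/-- There is a dominant polynomial mapping `F : ℂ³ → ℂ³` of degree 2 whose asymptotic set
is the union of two distinct planes. -/
theorem exists_asymptoticSet_two_planes :
    ∃ (P : Fin 3 → MvPolynomial (Fin 3) ℂ) (F : (Fin 3 → ℂ) → (Fin 3 → ℂ)),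
      IsDegTwoPolyMap P F ∧ Dense (Set.range F) ∧
      ∃ S₁ S₂ : Set (Fin 3 → ℂ), IsPlane S₁ ∧ IsPlane S₂ ∧ S₁ ≠ S₂ ∧
        asymptoticSet F = S₁ ∪ S₂ := by
  refine ⟨_, chainProductMap, isDegTwoPolyMap_chainProductMap, dense_range_chainProductMap, _, _,
    isPlane_coord_eq_zero 0, isPlane_coord_eq_zero 1, fun h => ?_, asymptoticSet_chainProductMap⟩
  have h' : (![0, 1, 0] : Fin 3 → ℂ) ∈ {a : Fin 3 → ℂ | a 1 = 0} := h ▸ rfl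
  simp at h'
end

section
/- There exists a dominant polynomial mapping F : ℂ³ → ℂ³ of degree 2 whose asymptotic set S_F is the union of a plane and a paraboloid. -/
open Filter Topology

/-- The polynomial mapping `(x, y, z) ↦ (x, x y + x², y z)`. -/
def quadMap (v : Fin 3 → ℂ) : Fin 3 → ℂ :=
  ![v 0, v 0 * v 1 + v 0 ^ 2, v 1 * v 2]

/-- The coordinate polynomials of `quadMap`. -/
noncomputable def quadPoly : Fin 3 → MvPolynomial (Fin 3) ℂ :=
  ![MvPolynomial.X 0, MvPolynomial.X 0 * MvPolynomial.X 1 + MvPolynomial.X 0 ^ 2,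
    MvPolynomial.X 1 * MvPolynomial.X 2]

theorem isDegTwoPolyMap_quadMap : IsDegTwoPolyMap quadPoly quadMap := by
  have hmul : ∀ i j : Fin 3,
      (MvPolynomial.X i * MvPolynomial.X j : MvPolynomial (Fin 3) ℂ).totalDegree = 2 := by
    intro i j
    rw [MvPolynomial.totalDegree_mul_of_isDomain (MvPolynomial.X_ne_zero i)
      (MvPolynomial.X_ne_zero j), MvPolynomial.totalDegree_X, MvPolynomial.totalDegree_X]
  refine ⟨fun x i => ?_, fun i => ?_, 2, hmul 1 2⟩
  · fin_cases i <;> simp [quadMap, quadPoly]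
  · fin_cases i
    · simp [quadPoly]
    · refine (MvPolynomial.totalDegree_add _ _).trans (max_le (hmul 0 1).le ?_)
      rw [MvPolynomial.totalDegree_X_pow]
    · exact (hmul 1 2).le

theorem mem_asymptoticSet_of_coord {n : ℕ} {F : (Fin n → ℂ) → (Fin n → ℂ)} {a : Fin n → ℂ}
    (ξ : ℕ → (Fin n → ℂ)) (i : Fin n) (hi : ∀ k, ξ k i = k)
    (hF : Tendsto (fun k => F (ξ k)) atTop (nhds a)) : a ∈ asymptoticSet F := by
  refine ⟨ξ, tendsto_atTop_mono (fun k => ?_) (tendsto_natCast_atTop_atTop (R := ℝ)), hF⟩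
  have h := norm_le_pi_norm (ξ k) i
  rwa [hi, Complex.norm_natCast] at h

theorem asymptoticSet_subset_closure_range {n : ℕ} (F : (Fin n → ℂ) → (Fin n → ℂ)) :
    asymptoticSet F ⊆ closure (Set.range F) := by
  rintro a ⟨ξ, -, h⟩
  exact mem_closure_of_tendsto h (Eventually.of_forall fun k => ⟨ξ k, rfl⟩)

theorem not_mem_asymptoticSet_of_tendsto {n : ℕ} {F : (Fin n → ℂ) → (Fin n → ℂ)}
    {a b : Fin n → ℂ} (h : ∀ ξ : ℕ → (Fin n → ℂ), Tendsto (fun k => F (ξ k)) atTop (nhds a) →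
      Tendsto ξ atTop (nhds b)) : a ∉ asymptoticSet F := by
  rintro ⟨ξ, hn, hF⟩
  exact not_tendsto_nhds_of_tendsto_atTop hn _ (h ξ hF).norm

theorem asymptoticSet_quadMap :
    asymptoticSet quadMap = {x | x 0 = 0} ∪ {x | x 0 ^ 2 - x 1 = 0} := by
  have hdiv : ∀ c : ℂ, Tendsto (fun k : ℕ => c / k) atTop (nhds 0) :=
    fun c => tendsto_const_div_atTop_nhds_zero_nat c
  have hcancel : ∀ c : ℂ, Tendsto (fun k : ℕ => c / k * k) atTop (nhds c) := by
    intro c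
    refine tendsto_const_nhds.congr' ?_
    filter_upwards [eventually_ne_atTop 0] with k hk
    field_simp
  ext a
  constructor
  · contrapose!
    intro ha
    simp only [Set.mem_union, Set.mem_ofPred_eq, not_or] at ha
    obtain ⟨h0, h1⟩ := ha
    have hy : (a 1 - a 0 ^ 2) / a 0 ≠ 0 :=
      div_ne_zero (fun h => h1 (by linear_combination -h)) h0
    refine not_mem_asymptoticSet_of_tendsto
      (b := ![a 0, (a 1 - a 0 ^ 2) / a 0, a 2 / ((a 1 - a 0 ^ 2) / a 0)]) fun ξ hF => ?_
    rw [tendsto_pi_nhds] at hF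
    have l0 : Tendsto (fun k => ξ k 0) atTop (nhds (a 0)) := hF 0
    have l1 : Tendsto (fun k => ξ k 1) atTop (nhds ((a 1 - a 0 ^ 2) / a 0)) := by
      have h : Tendsto (fun k => ξ k 0 * ξ k 1 + ξ k 0 ^ 2) atTop (nhds (a 1)) := hF 1
      refine ((h.sub (l0.pow 2)).div l0 h0).congr' ?_
      filter_upwards [l0.eventually_ne h0] with k hk
      simp only [Pi.div_apply]
      field_simp
      ring
    have l2 : Tendsto (fun k => ξ k 2) atTop (nhds (a 2 / ((a 1 - a 0 ^ 2) / a 0))) := by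
      have h : Tendsto (fun k => ξ k 1 * ξ k 2) atTop (nhds (a 2)) := hF 2
      refine (h.div l1 hy).congr' ?_
      filter_upwards [l1.eventually_ne hy] with k hk
      simp only [Pi.div_apply]
      field_simp
    rw [tendsto_pi_nhds]
    intro i
    fin_cases i
    exacts [l0, l1, l2]
  · rintro (h | h)
    · refine mem_asymptoticSet_of_coord (fun k => ![a 1 / k, k, a 2 / k]) 1 (fun k => rfl) ?_
      rw [tendsto_pi_nhds]
      intro i
      fin_cases i
      · simpa [quadMap, show a 0 = 0 from h] using hdiv (a 1)
      · simpa [quadMap] using (hcancel (a 1)).add ((hdiv (a 1)).pow 2)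
      · simpa [quadMap, mul_comm] using hcancel (a 2)
    · refine mem_asymptoticSet_of_coord (fun k => ![a 0, a 2 / k, k]) 2 (fun k => rfl) ?_
      rw [tendsto_pi_nhds]
      intro i
      fin_cases i
      · simp [quadMap]
      · simpa [quadMap, ← sub_eq_zero.mp h] using
          ((hdiv (a 2)).const_mul (a 0)).add_const (a 0 ^ 2)
      · simpa [quadMap] using hcancel (a 2)

theorem dense_range_quadMap : Dense (Set.range quadMap) := by
  intro a
  by_cases ha : a ∈ asymptoticSet quadMap
  · exact asymptoticSet_subset_closure_range _ ha
  · rw [asymptoticSet_quadMap] at ha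
    simp only [Set.mem_union, Set.mem_ofPred_eq, not_or] at ha
    obtain ⟨h0, h1⟩ := ha
    have h2 : a 1 - a 0 ^ 2 ≠ 0 := fun h => h1 (by linear_combination -h)
    refine subset_closure
      ⟨![a 0, (a 1 - a 0 ^ 2) / a 0, a 2 / ((a 1 - a 0 ^ 2) / a 0)], ?_⟩
    ext i
    fin_cases i
    · simp [quadMap]
    · simp [quadMap]
      field_simp
      ring
    · simp [quadMap]
      field_simp

/-- There is a dominant polynomial mapping `F : ℂ³ → ℂ³` of degree 2 whose asymptotic set
is the union of a plane and a paraboloid. -/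
theorem exists_asymptoticSet_plane_union_paraboloid :
    ∃ (P : Fin 3 → MvPolynomial (Fin 3) ℂ) (F : (Fin 3 → ℂ) → (Fin 3 → ℂ)),
      IsDegTwoPolyMap P F ∧ Dense (Set.range F) ∧
      ∃ S₁ S₂ : Set (Fin 3 → ℂ), IsPlane S₁ ∧ IsParaboloid S₂ ∧
        asymptoticSet F = S₁ ∪ S₂ := by
  refine ⟨quadPoly, quadMap, isDegTwoPolyMap_quadMap, dense_range_quadMap,
    _, _, ?_, ?_, asymptoticSet_quadMap⟩
  · exact ⟨MvPolynomial.X 0, MvPolynomial.totalDegree_X 0, by simp⟩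
  · refine ⟨0, 1, 2, 1, -1, 0, 0, by decide, by decide, by decide, one_ne_zero, by simp, ?_⟩
    ext x
    simp [sub_eq_add_neg]
end

section
/- There exists a dominant polynomial mapping F : ℂ³ → ℂ³ of degree 2 whose asymptotic set S_F is the union of three pairwise distinct planes. -/
open Filter Topology

open MvPolynomial

/-- The map `(x, y, z) ↦ (yz, zx, xy)`, written with cyclic indices. -/
def pairwiseMul (x : Fin 3 → ℂ) (i : Fin 3) : ℂ := x (i + 1) * x (i + 2)

theorem mem_range_pairwiseMul {a : Fin 3 → ℂ} (ha : ∀ i, a i ≠ 0) :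
    a ∈ Set.range pairwiseMul := by
  obtain ⟨s, hs⟩ := IsAlgClosed.exists_pow_nat_eq (a 0 * a 1 * a 2) two_pos
  refine ⟨fun i => s / a i, funext fun i => ?_⟩
  have h0 := ha 0
  have h1 := ha 1
  have h2 := ha 2
  fin_cases i <;> simp [pairwiseMul] <;> field_simp <;> linear_combination hs

theorem dense_range_pairwiseMul : Dense (Set.range pairwiseMul) := by
  have h : Dense (Set.pi Set.univ fun _ : Fin 3 => ({0}ᶜ : Set ℂ)) :=
    dense_pi _ fun _ _ => dense_compl_singleton 0
  exact h.mono fun a ha => mem_range_pairwiseMul fun i => by simpa using ha i (Set.mem_univ i)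

/-- Where no coordinate of `pairwiseMul x` vanishes, each `x i ^ 2` is a quotient of them. -/
theorem sq_eq_pairwiseMul_div {x : Fin 3 → ℂ} {i : Fin 3} (hi : pairwiseMul x i ≠ 0) :
    x i ^ 2 = pairwiseMul x (i + 1) * pairwiseMul x (i + 2) / pairwiseMul x i := by
  rw [eq_div_iff hi]
  fin_cases i <;> simp [pairwiseMul] <;> ring

theorem exists_eq_zero_of_mem_asymptoticSet {a : Fin 3 → ℂ}
    (ha : a ∈ asymptoticSet pairwiseMul) : ∃ i, a i = 0 := by
  by_contra! h
  obtain ⟨ξ, hξ, hF⟩ := ha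
  rw [tendsto_pi_nhds] at hF
  have hsq (i : Fin 3) : Tendsto (fun k => ξ k i ^ 2) atTop (𝓝 (a (i + 1) * a (i + 2) / a i)) := by
    refine (((hF (i + 1)).mul (hF (i + 2))).div (hF i) (h i)).congr' ?_
    filter_upwards [(hF i).eventually_ne (h i)] with k hk
    exact (sq_eq_pairwiseMul_div hk).symm
  have hsum := tendsto_finsetSum Finset.univ fun i _ => (hsq i).norm.const_add 1
  refine not_tendsto_nhds_of_tendsto_atTop (tendsto_atTop_mono (fun k => ?_) hξ) _ hsum
  have hle (i : Fin 3) : ‖ξ k i‖ ≤ 1 + ‖ξ k i ^ 2‖ := by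
    rw [norm_pow]
    nlinarith [sq_nonneg (‖ξ k i‖ - 1), sq_nonneg ‖ξ k i‖]
  refine (pi_norm_le_iff_of_nonneg (by positivity)).2 fun i => (hle i).trans ?_
  exact Finset.single_le_sum (f := fun i => 1 + ‖ξ k i ^ 2‖) (fun _ _ => by positivity)
    (Finset.mem_univ i)

theorem mem_asymptoticSet_of_eq_zero {a : Fin 3 → ℂ} {i : Fin 3} (hi : a i = 0) :
    a ∈ asymptoticSet pairwiseMul := by
  -- Off `i`, the index `-(i + j)` is the one distinct from both `i` and `j`.
  let ξ : ℕ → Fin 3 → ℂ := fun k j => if j = i then k + 1 else a (-(i + j)) * (1 / (k + 1))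
  have hne (k : ℕ) : (k : ℂ) + 1 ≠ 0 := by exact_mod_cast k.succ_ne_zero
  refine ⟨ξ, ?_, tendsto_pi_nhds.2 fun j => ?_⟩
  · refine tendsto_atTop_mono (fun k => ?_) tendsto_natCast_atTop_atTop
    calc (k : ℝ) ≤ ‖((k + 1 : ℕ) : ℂ)‖ := by rw [Complex.norm_natCast]; simp
      _ = ‖ξ k i‖ := by simp [ξ]
      _ ≤ ‖ξ k‖ := norm_le_pi_norm _ _
  · have hinv := tendsto_one_div_add_atTop_nhds_zero_nat (𝕜 := ℂ)
    have hj : j = i ∨ ∀ k, pairwiseMul (ξ k) j = a j := by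
      refine or_iff_not_imp_left.2 fun hji k => ?_
      have := hne k
      fin_cases i <;> fin_cases j <;> first
        | exact absurd rfl hji
        | (simp [ξ, pairwiseMul]; field_simp; rfl)
    rcases hj with rfl | hj
    · have h := (hinv.const_mul (a (-(j + (j + 1))))).mul (hinv.const_mul (a (-(j + (j + 2)))))
      simpa [ξ, pairwiseMul, hi] using h
    · simp [hj]

theorem isPlane_coordinate (i : Fin 3) : IsPlane {x | x i = 0} :=
  ⟨X i, totalDegree_X i, by simp⟩

theorem setOf_coordinate_eq_zero_ne {i j : Fin 3} (hij : i ≠ j) :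
    {x : Fin 3 → ℂ | x i = 0} ≠ {x | x j = 0} := by
  intro h
  have hmem : Pi.single j (1 : ℂ) ∈ {x : Fin 3 → ℂ | x i = 0} := by simp [hij]
  rw [h] at hmem
  simp at hmem

theorem isDegTwoPolyMap_pairwiseMul :
    IsDegTwoPolyMap (fun i => X (i + 1) * X (i + 2)) pairwiseMul := by
  have hdeg (i : Fin 3) : (X (i + 1) * X (i + 2) : MvPolynomial (Fin 3) ℂ).totalDegree = 2 := by
    rw [totalDegree_mul_of_isDomain (X_ne_zero _) (X_ne_zero _), totalDegree_X, totalDegree_X]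
  exact ⟨fun x i => by simp [pairwiseMul], fun i => (hdeg i).le, 0, hdeg 0⟩

/-- There is a dominant polynomial mapping `F : ℂ³ → ℂ³` of degree 2 whose asymptotic set
is the union of three pairwise distinct planes. -/
theorem exists_asymptoticSet_three_planes :
    ∃ (P : Fin 3 → MvPolynomial (Fin 3) ℂ) (F : (Fin 3 → ℂ) → (Fin 3 → ℂ)),
      IsDegTwoPolyMap P F ∧ Dense (Set.range F) ∧
      ∃ S₁ S₂ S₃ : Set (Fin 3 → ℂ), IsPlane S₁ ∧ IsPlane S₂ ∧ IsPlane S₃ ∧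
        S₁ ≠ S₂ ∧ S₂ ≠ S₃ ∧ S₁ ≠ S₃ ∧ asymptoticSet F = S₁ ∪ S₂ ∪ S₃ := by
  refine ⟨_, pairwiseMul, isDegTwoPolyMap_pairwiseMul, dense_range_pairwiseMul,
    {x | x 0 = 0}, {x | x 1 = 0}, {x | x 2 = 0},
    isPlane_coordinate 0, isPlane_coordinate 1, isPlane_coordinate 2,
    setOf_coordinate_eq_zero_ne (by decide), setOf_coordinate_eq_zero_ne (by decide),
    setOf_coordinate_eq_zero_ne (by decide), Set.ext fun a => ⟨fun ha => ?_, ?_⟩⟩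
  · obtain ⟨i, hi⟩ := exists_eq_zero_of_mem_asymptoticSet ha
    fin_cases i
    exacts [.inl (.inl hi), .inl (.inr hi), .inr hi]
  · rintro ((h | h) | h) <;> exact mem_asymptoticSet_of_eq_zero h
end

section
/- Let F : ℂ³ → ℂ³ be a dominant polynomial mapping of degree 2 with S_F ≠ ∅. Suppose S_F contains the zero set Z of an irreducible polynomial P of total degree 2 of the diagonal form P = r₁·x₁^{p₁} + r₂·x₂^{p₂} + r₃·x₃^{p₃} + r₄. Then there is exactly one index i ∈ {1, 2, 3} with r_i ≠ 0 and p_i = 2, and there exists an index j ≠ i with r_j ≠ 0 and p_j = 1; in particular, Z is a paraboloid. -/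
open Filter Topology

theorem eventually_norm_le_of_polynomial_relation {d : ℕ} {c : ℕ → ℕ → ℂ} {b : ℕ → ℂ} {x : ℕ → ℂ}
    (hc : ∀ j, Tendsto (c j) atTop (𝓝 (b j))) (hb : b d ≠ 0)
    (h : ∀ k, ∑ j ∈ Finset.range (d + 1), c j k * x k ^ j = 0) :
    ∃ M : ℝ, ∀ᶠ k in atTop, ‖x k‖ ≤ M := by
  have hpos : 0 < ‖b d‖ := norm_pos_iff.2 hb
  set S : ℝ := ∑ j ∈ Finset.range d, (‖b j‖ + 1) with hS
  have hS0 : 0 ≤ S := Finset.sum_nonneg fun j _ => by positivity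
  refine ⟨max 1 (S / (‖b d‖ / 2)), ?_⟩
  have h1 : ∀ᶠ k in atTop, ∀ j ∈ Finset.range d, ‖c j k‖ ≤ ‖b j‖ + 1 := by
    rw [Filter.eventually_all_finset]
    intro j _
    exact ((hc j).norm.eventually (gt_mem_nhds (lt_add_one _))).mono fun k hk => hk.le
  have h2 : ∀ᶠ k in atTop, ‖b d‖ / 2 < ‖c d k‖ :=
    (hc d).norm.eventually (lt_mem_nhds (by linarith))
  filter_upwards [h1, h2] with k hk1 hk2
  by_contra! hlt
  obtain ⟨hx1, hx2⟩ := max_lt_iff.1 hlt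
  have hx0 : 0 < ‖x k‖ := by linarith
  have hk := h k
  rw [Finset.sum_range_succ] at hk
  have e1 : ‖c d k‖ * ‖x k‖ ^ d ≤ ∑ j ∈ Finset.range d, (‖b j‖ + 1) * ‖x k‖ ^ j := by
    have : c d k * x k ^ d = -∑ j ∈ Finset.range d, c j k * x k ^ j := by
      linear_combination hk
    rw [← norm_pow, ← norm_mul, this, norm_neg]
    refine (norm_sum_le _ _).trans (Finset.sum_le_sum fun j hj => ?_)
    rw [norm_mul, norm_pow]
    gcongr
    exact hk1 j hj
  rcases d with _ | m
  · simp at e1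
    rw [e1, norm_zero] at hk2
    linarith
  have e2 : ∑ j ∈ Finset.range (m + 1), (‖b j‖ + 1) * ‖x k‖ ^ j ≤ S * ‖x k‖ ^ m := by
    rw [hS, Finset.sum_mul]
    refine Finset.sum_le_sum fun j hj => ?_
    have : j ≤ m := Nat.lt_succ_iff.1 (Finset.mem_range.1 hj)
    gcongr
    exact hx1.le
  rw [div_lt_iff₀ (by positivity)] at hx2
  have hp : 0 < ‖x k‖ ^ m := by positivity
  rw [pow_succ] at e1
  have : ‖b (m + 1)‖ / 2 * ‖x k‖ < ‖c (m + 1) k‖ * ‖x k‖ := by gcongr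
  nlinarith

/-- A polynomial vanishing on a dense set of values is zero. -/
theorem eq_zero_of_eval_dense {n : ℕ} {s : Set (Fin n → ℂ)} (hs : Dense s)
    {f : MvPolynomial (Fin n) ℂ} (h : ∀ y ∈ s, MvPolynomial.eval y f = 0) : f = 0 := by
  have hc : (fun y => MvPolynomial.eval y f) = fun _ => 0 :=
    Continuous.ext_on hs (MvPolynomial.continuous_eval f) continuous_const h
  exact MvPolynomial.funext fun y => by simpa using congrFun hc y

theorem exists_polynomial_relation {n : ℕ} {P : Fin n → MvPolynomial (Fin n) ℂ}
    {F : (Fin n → ℂ) → (Fin n → ℂ)} (hP : ∀ x i, F x i = MvPolynomial.eval x (P i))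
    (hdom : Dense (Set.range F)) (i : Fin n) :
    ∃ (d : ℕ) (c : ℕ → MvPolynomial (Fin n) ℂ), c d ≠ 0 ∧
      ∀ x, ∑ j ∈ Finset.range (d + 1), MvPolynomial.eval (F x) (c j) * x i ^ j = 0 := by
  have heval : ∀ x f, MvPolynomial.eval x (MvPolynomial.aeval P f) =
      MvPolynomial.eval (F x) f := by
    intro x f
    have hF : F x = fun i => MvPolynomial.eval x (P i) := funext (hP x)
    rw [hF, ← MvPolynomial.coe_aeval_eq_eval, ← MvPolynomial.coe_aeval_eq_eval]
    exact MvPolynomial.comp_aeval_apply P (MvPolynomial.aeval x) f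
  have hind : AlgebraicIndependent ℂ P := by
    rw [algebraicIndependent_iff]
    intro f hf
    refine eq_zero_of_eval_dense hdom ?_
    rintro _ ⟨x, rfl⟩
    rw [← heval, hf, map_zero]
  have htb : IsTranscendenceBasis ℂ P :=
    hind.isTranscendenceBasis_of_lift_trdeg_le_of_finite (by
      rw [MvPolynomial.trdeg_of_isDomain]; simp)
  have halg := htb.isAlgebraic
  obtain ⟨g, hg0, hg⟩ := halg.isAlgebraic (MvPolynomial.X i : MvPolynomial (Fin n) ℂ)
  have hlift : ∀ j, ∃ f : MvPolynomial (Fin n) ℂ,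
      MvPolynomial.aeval P f = (g.coeff j : MvPolynomial (Fin n) ℂ) := by
    intro j
    exact (Algebra.adjoin_range_eq_range_aeval ℂ P).le (g.coeff j).2
  choose c hc using hlift
  refine ⟨g.natDegree, c, ?_, ?_⟩
  · intro h0
    have := hc g.natDegree
    rw [h0, map_zero] at this
    exact hg0 (Polynomial.leadingCoeff_eq_zero.1 (Subtype.ext this.symm))
  · intro x
    rw [Polynomial.aeval_eq_sum_range] at hg
    have := congrArg (MvPolynomial.eval x) hg
    rw [map_sum, map_zero] at this
    rw [← this]
    refine Finset.sum_congr rfl fun j _ => ?_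
    rw [← heval, hc, Algebra.smul_def, map_mul, map_pow, MvPolynomial.eval_X]
    rfl

/-- The asymptotic set of a dominant polynomial mapping is contained in a proper algebraic set. -/
theorem exists_ne_zero_vanishing_on_asymptoticSet {n : ℕ} {P : Fin n → MvPolynomial (Fin n) ℂ}
    {F : (Fin n → ℂ) → (Fin n → ℂ)} (hP : ∀ x i, F x i = MvPolynomial.eval x (P i))
    (hdom : Dense (Set.range F)) :
    ∃ R : MvPolynomial (Fin n) ℂ, R ≠ 0 ∧ ∀ a ∈ asymptoticSet F, MvPolynomial.eval a R = 0 := by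
  choose d c hcd hrel using exists_polynomial_relation hP hdom
  refine ⟨∏ i, c i (d i), Finset.prod_ne_zero_iff.2 fun i _ => hcd i, ?_⟩
  rintro a ⟨ξ, hξ, hFξ⟩
  by_contra hne
  rw [map_prod, ← ne_eq, Finset.prod_ne_zero_iff] at hne
  have hbdd : ∀ i, ∃ M : ℝ, ∀ᶠ k in atTop, ‖ξ k i‖ ≤ M := fun i =>
    eventually_norm_le_of_polynomial_relation
      (c := fun j k => MvPolynomial.eval (F (ξ k)) (c i j))
      (fun j => ((MvPolynomial.continuous_eval (c i j)).tendsto a).comp hFξ)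
      (hne i (Finset.mem_univ i)) (fun k => hrel i (ξ k))
  choose M hM using hbdd
  obtain ⟨k, hk1, hk2⟩ :=
    ((Filter.eventually_all.2 hM).and (hξ.eventually_gt_atTop (∑ i, |M i|))).exists
  refine absurd hk2 (not_lt.2 ((pi_norm_le_iff_of_nonneg (by positivity)).2 fun i => ?_))
  exact ((hk1 i).trans (le_abs_self _)).trans
    (Finset.single_le_sum (f := fun i => |M i|) (fun _ _ => abs_nonneg _) (Finset.mem_univ i))

section PolynomialFacts

open MvPolynomial

variable {n : ℕ}

theorem dvd_of_vanishing {Q f : MvPolynomial (Fin n) ℂ} (hQ : Irreducible Q)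
    (h : ∀ x, eval x Q = 0 → eval x f = 0) : Q ∣ f := by
  have hprime : (Ideal.span {Q}).IsPrime :=
    (Ideal.span_singleton_prime hQ.ne_zero).2 hQ.prime
  have := IsPrime.vanishingIdeal_zeroLocus (K := ℂ) (Ideal.span {Q})
  rw [← Ideal.mem_span_singleton, ← this, mem_vanishingIdeal_iff]
  intro x hx
  rw [zeroLocus_span] at hx
  exact h x (hx Q rfl)

/-- Restriction of a polynomial to the line `s ↦ a + s • w`. -/
theorem eval_restrict_line (f : MvPolynomial (Fin n) ℂ) (a w : Fin n → ℂ) (s : ℂ) :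
    Polynomial.eval s
      (aeval (fun i => Polynomial.C (a i) + Polynomial.X * Polynomial.C (w i)) f) =
        eval (a + s • w) f := by
  rw [← Polynomial.coe_aeval_eq_eval, ← coe_aeval_eq_eval]
  have h := comp_aeval_apply (fun i => Polynomial.C (a i) + Polynomial.X * Polynomial.C (w i))
    (Polynomial.aeval s) f
  have hfun : (fun i => Polynomial.aeval s
      (Polynomial.C (a i) + Polynomial.X * Polynomial.C (w i))) = a + s • w := by
    ext i
    simp
    ring
  rw [hfun] at h
  exact h

/-- Off a proper closed subset of an irreducible hypersurface, every line lying in the zero set of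
a given nonzero polynomial and meeting the hypersurface stays in the hypersurface. -/
theorem exists_generic_locus {Q R : MvPolynomial (Fin n) ℂ} (hQ : Irreducible Q) (hR : R ≠ 0) :
    ∃ R' : MvPolynomial (Fin n) ℂ,
      (∃ a, eval a Q = 0 ∧ eval a R' ≠ 0) ∧
      (∀ f, (∀ a, eval a Q = 0 → eval a R' ≠ 0 → eval a f = 0) → Q ∣ f) ∧
      (∀ a w, eval a R' ≠ 0 → (∀ s : ℂ, eval (a + s • w) R = 0) →
        ∀ s : ℂ, eval (a + s • w) Q = 0) := by
  obtain ⟨m, R', hndvd, rfl⟩ :=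
    WfDvdMonoid.max_power_factor (a₀ := R) (x := Q) hR hQ
  refine ⟨R', ?_, ?_, ?_⟩
  · by_contra! h
    exact hndvd (dvd_of_vanishing hQ h)
  · intro f hf
    have : Q ∣ f * R' := dvd_of_vanishing hQ fun x hx => by
      by_cases h : eval x R' = 0
      · simp [h]
      · simp [hf x hx h]
    exact (hQ.prime.dvd_or_dvd this).resolve_right hndvd
  · intro a w ha hline
    have hQl := eval_restrict_line Q a w
    have hRl := eval_restrict_line R' a w
    set q := aeval (fun i => Polynomial.C (a i) + Polynomial.X * Polynomial.C (w i)) Q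
    set ρ := aeval (fun i => Polynomial.C (a i) + Polynomial.X * Polynomial.C (w i)) R'
    have h0 : q ^ m * ρ = 0 := by
      refine Polynomial.funext fun s => ?_
      have := hline s
      rw [map_mul, map_pow] at this
      rw [Polynomial.eval_mul, Polynomial.eval_pow, hQl, hRl, this, Polynomial.eval_zero]
    have hρ : ρ ≠ 0 := by
      intro h
      have := hRl 0
      rw [h] at this
      simp at this
      exact ha this.symm
    have hq : q = 0 := eq_zero_of_pow_eq_zero ((mul_eq_zero.1 h0).resolve_right hρ)
    intro s
    rw [← hQl, hq, Polynomial.eval_zero]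

/-- The polynomial of a linear functional. -/
noncomputable def linPoly (f : (Fin n → ℂ) →ₗ[ℂ] ℂ) : MvPolynomial (Fin n) ℂ :=
  ∑ i, C (f (Pi.single i 1)) * X i

theorem eval_linPoly (f : (Fin n → ℂ) →ₗ[ℂ] ℂ) (x : Fin n → ℂ) : eval x (linPoly f) = f x := by
  conv_rhs => rw [LinearMap.pi_apply_eq_sum_univ f x]
  simp only [linPoly, map_sum, map_mul, eval_C, eval_X, smul_eq_mul, mul_comm]
  refine Finset.sum_congr rfl fun i _ => ?_
  congr 2
  ext j
  simp [Pi.single_apply, eq_comm]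

theorem totalDegree_linPoly_le (f : (Fin n → ℂ) →ₗ[ℂ] ℂ) : (linPoly f).totalDegree ≤ 1 :=
  totalDegree_finsetSum_le fun i _ =>
    (totalDegree_mul _ _).trans (by simp [totalDegree_X])

theorem totalDegree_linPoly_sub_C {f : (Fin n → ℂ) →ₗ[ℂ] ℂ} (hf : f ≠ 0) (c : ℂ) :
    (linPoly f - C c).totalDegree = 1 := by
  refine le_antisymm ?_ ?_
  · exact (totalDegree_sub_C_le _ _).trans (totalDegree_linPoly_le f)
  · rw [Nat.one_le_iff_ne_zero]
    intro h
    rw [totalDegree_eq_zero_iff_eq_C] at h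
    apply hf
    ext x
    have h1 := congrArg (eval (Pi.single x 1)) h
    have h2 := congrArg (eval 0) h
    rw [map_sub, eval_linPoly, eval_C, eval_C] at h1 h2
    rw [map_zero] at h2
    simp
    linear_combination h1 - h2

theorem irreducible_of_totalDegree_eq_one' {p : MvPolynomial (Fin n) ℂ} (hp : p.totalDegree = 1) :
    Irreducible p := by
  refine irreducible_of_totalDegree_eq_one hp fun x hx => ?_
  rw [isUnit_iff_ne_zero]
  rintro rfl
  have : p = 0 := by
    ext m
    simpa using hx m
  simp [this] at hp

theorem not_plane_subset_zeros {Q : MvPolynomial (Fin 3) ℂ} (hQ : Irreducible Q)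
    (hdeg : Q.totalDegree = 2) {w₁ w₂ : Fin 3 → ℂ} (hw : LinearIndependent ℂ ![w₁, w₂])
    (a : Fin 3 → ℂ) : ∃ s t : ℂ, eval (a + s • w₁ + t • w₂) Q ≠ 0 := by
  by_contra! h
  have hrank := finrank_span_eq_card hw
  have hlt : Submodule.span ℂ (Set.range ![w₁, w₂]) < ⊤ := by
    refine lt_top_iff_ne_top.2 fun htop => ?_
    rw [htop] at hrank
    simp at hrank
  obtain ⟨f, hf0, hf⟩ := Submodule.exists_le_ker_of_lt_top _ hlt
  have hker : Submodule.span ℂ (Set.range ![w₁, w₂]) = LinearMap.ker f := by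
    refine Submodule.eq_of_le_of_finrank_le hf ?_
    have h1 := LinearMap.finrank_range_add_finrank_ker f
    have h2 : LinearMap.range f = ⊤ := LinearMap.range_eq_top.2 (LinearMap.surjective hf0)
    rw [h2] at h1
    simp at h1 hrank
    omega
  have hl1 := totalDegree_linPoly_sub_C hf0 (f a)
  have hirr := irreducible_of_totalDegree_eq_one' hl1
  have hdvd : linPoly f - C (f a) ∣ Q := dvd_of_vanishing hirr fun x hx => by
    rw [map_sub, eval_linPoly, eval_C, ← map_sub] at hx
    have hmem : x - a ∈ Submodule.span ℂ (Set.range ![w₁, w₂]) := hker ▸ hx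
    simp only [Matrix.range_cons, Matrix.range_empty, Set.union_empty, Set.singleton_union,
      Submodule.mem_span_pair] at hmem
    obtain ⟨s, t, hst⟩ := hmem
    have := h s t
    rwa [add_assoc, hst, add_sub_cancel] at this
  obtain ⟨D, hD⟩ := hdvd
  rcases hQ.isUnit_or_isUnit hD with hu | hu
  · exact hirr.not_isUnit hu
  · have := isUnit_iff_totalDegree_of_isReduced.1 hu
    rw [hD, totalDegree_mul_of_isDomain hirr.ne_zero hu.ne_zero, hl1, this.2] at hdeg
    omega

/-- An irreducible quadric dividing a polynomial of degree at most two agrees with it up to a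
scalar. -/
theorem eval_eq_mul_of_dvd {Q f : MvPolynomial (Fin n) ℂ} (hdeg : Q.totalDegree = 2)
    (hf : f.totalDegree ≤ 2) (h : Q ∣ f) : ∃ d : ℂ, ∀ x, eval x f = d * eval x Q := by
  obtain ⟨D, rfl⟩ := h
  by_cases hD : D = 0
  · exact ⟨0, by simp [hD]⟩
  have hQ0 : Q ≠ 0 := by
    rintro rfl
    simp at hdeg
  rw [totalDegree_mul_of_isDomain hQ0 hD, hdeg] at hf
  obtain ⟨d, rfl⟩ : ∃ d, D = C d := ⟨_, totalDegree_eq_zero_iff_eq_C.1 (by omega)⟩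
  exact ⟨d, fun x => by simp [mul_comm]⟩

end PolynomialFacts

section QuadraticMaps

variable {n : ℕ}

/-- The differential at `p` of the quadratic mapping `x ↦ c + L x + B x x`. -/
def quadDeriv (L : (Fin n → ℂ) →ₗ[ℂ] (Fin n → ℂ))
    (B : (Fin n → ℂ) →ₗ[ℂ] (Fin n → ℂ) →ₗ[ℂ] (Fin n → ℂ)) (p : Fin n → ℂ) :
    (Fin n → ℂ) →ₗ[ℂ] (Fin n → ℂ) :=
  L + B p + B.flip p

/-- `F`, taken modulo the direction `w`, tends to `a` along a sequence going to infinity in the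
direction `v`. -/
def AsymptoticAlong (F : (Fin n → ℂ) → (Fin n → ℂ)) (w a v : Fin n → ℂ) : Prop :=
  ∃ (ξ : ℕ → Fin n → ℂ) (e ρ : ℕ → ℂ), Tendsto e atTop (𝓝 0) ∧
    Tendsto (fun k => e k • ξ k) atTop (𝓝 v) ∧
    Tendsto (fun k => F (ξ k) - ρ k • w) atTop (𝓝 a)

theorem tendsto_norm_atTop_of_tendsto_smul {ξ : ℕ → Fin n → ℂ} {e : ℕ → ℂ} {v : Fin n → ℂ}
    (he : Tendsto e atTop (𝓝 0)) (hξ : Tendsto (fun k => e k • ξ k) atTop (𝓝 v)) (hv : v ≠ 0) :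
    Tendsto (fun k => ‖ξ k‖) atTop atTop := by
  have hv0 : 0 < ‖v‖ := norm_pos_iff.2 hv
  rw [tendsto_atTop]
  intro M
  have h1 : ∀ᶠ k in atTop, ‖v‖ / 2 < ‖e k • ξ k‖ :=
    hξ.norm.eventually (lt_mem_nhds (by linarith))
  have h2 : ∀ᶠ k in atTop, ‖e k‖ < ‖v‖ / 2 / (|M| + 1) := by
    have := he.norm
    rw [norm_zero] at this
    exact this.eventually (gt_mem_nhds (by positivity))
  filter_upwards [h1, h2] with k hk1 hk2
  rw [norm_smul] at hk1
  rw [lt_div_iff₀ (by positivity)] at hk2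
  by_contra! hlt
  have : ‖ξ k‖ ≤ |M| + 1 := by linarith [le_abs_self M]
  have : ‖e k‖ * ‖ξ k‖ ≤ ‖e k‖ * (|M| + 1) := by gcongr
  linarith

theorem AsymptoticAlong.mem_asymptoticSet {F : (Fin n → ℂ) → (Fin n → ℂ)} {a v : Fin n → ℂ}
    (h : AsymptoticAlong F 0 a v) (hv : v ≠ 0) : a ∈ asymptoticSet F := by
  obtain ⟨ξ, e, ρ, he, hξ, hF⟩ := h
  exact ⟨ξ, tendsto_norm_atTop_of_tendsto_smul he hξ hv, by simpa using hF⟩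

theorem AsymptoticAlong.add_smul {F : (Fin n → ℂ) → (Fin n → ℂ)} {w a v : Fin n → ℂ}
    (h : AsymptoticAlong F w a v) (s : ℂ) : AsymptoticAlong F w (a + s • w) v := by
  obtain ⟨ξ, e, ρ, he, hξ, hF⟩ := h
  refine ⟨ξ, e, fun k => ρ k - s, he, hξ, (hF.add_const (s • w)).congr fun k => ?_⟩
  module

theorem exists_subseq_direction {ξ : ℕ → Fin n → ℂ}
    (h : Tendsto (fun k => ‖ξ k‖) atTop atTop) :
    ∃ (φ : ℕ → ℕ) (e : ℕ → ℂ) (v : Fin n → ℂ), StrictMono φ ∧ v ≠ 0 ∧ Tendsto e atTop (𝓝 0) ∧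
      Tendsto (fun k => e k • ξ (φ k)) atTop (𝓝 v) := by
  have hb : ∀ k, (((‖ξ k‖⁻¹ : ℝ) : ℂ) • ξ k) ∈ Metric.closedBall (0 : Fin n → ℂ) 1 := by
    intro k
    rw [mem_closedBall_zero_iff, norm_smul]
    simp only [Complex.norm_real, norm_inv, norm_norm]
    exact inv_mul_le_one
  obtain ⟨v, -, φ, hφ, hv⟩ := (isCompact_closedBall _ _).tendsto_subseq hb
  refine ⟨φ, fun k => ((‖ξ (φ k)‖⁻¹ : ℝ) : ℂ), v, hφ, ?_, ?_, hv⟩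
  · rintro rfl
    have h1 := hv.norm
    have h2 : ∀ᶠ k in atTop, ‖((fun k => (((‖ξ k‖⁻¹ : ℝ) : ℂ) • ξ k)) ∘ φ) k‖ = 1 := by
      filter_upwards [(h.comp hφ.tendsto_atTop).eventually_gt_atTop 0] with k hk
      simp only [Function.comp_apply] at hk ⊢
      rw [norm_smul]
      simp only [Complex.norm_real, norm_inv, norm_norm]
      exact inv_mul_cancel₀ hk.ne'
    have h3 := tendsto_nhds_unique h1 (tendsto_const_nhds.congr' (h2.mono fun k hk => hk.symm))
    simp at h3
  · have h4 := tendsto_inv_atTop_zero.comp (h.comp hφ.tendsto_atTop)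
    have := (Complex.continuous_ofReal.tendsto 0).comp h4
    rw [Complex.ofReal_zero] at this
    exact this

variable {F : (Fin n → ℂ) → (Fin n → ℂ)} {c : Fin n → ℂ}
  {L : (Fin n → ℂ) →ₗ[ℂ] (Fin n → ℂ)}
  {B : (Fin n → ℂ) →ₗ[ℂ] (Fin n → ℂ) →ₗ[ℂ] (Fin n → ℂ)}

theorem quadMap_add_smul (hF : ∀ x, F x = c + L x + B x x) (p y : Fin n → ℂ) (t : ℂ) :
    F (p + t • y) = F p + t • quadDeriv L B p y + t ^ 2 • B y y := by
  simp only [hF, quadDeriv, map_add, map_smul, LinearMap.add_apply, LinearMap.smul_apply,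
    LinearMap.flip_apply]
  module

theorem continuous_quadMap (hF : ∀ x, F x = c + L x + B x x) : Continuous F := by
  have hBi : ∀ x, B x x = ∑ i, x i • B (Pi.single i 1) x := fun x => by
    conv_lhs => rw [LinearMap.pi_apply_eq_sum_univ B x]
    simp only [LinearMap.sum_apply, LinearMap.smul_apply]
    refine Finset.sum_congr rfl fun i _ => ?_
    congr 3
    ext j
    simp [Pi.single_apply, eq_comm]
  have hc : Continuous fun x => c + L x + ∑ i, x i • B (Pi.single i 1) x := by
    have h1 : Continuous L := L.continuous_of_finiteDimensional
    have h2 : ∀ i, Continuous (B (Pi.single i 1)) := fun i =>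
      LinearMap.continuous_of_finiteDimensional _
    fun_prop
  exact hc.congr fun x => by rw [hF, ← hBi]

theorem AsymptoticAlong.add_smul_quadDeriv (hF : ∀ x, F x = c + L x + B x x)
    {w a v : Fin n → ℂ} (h : AsymptoticAlong F w a v) (p : Fin n → ℂ) (s : ℂ) :
    AsymptoticAlong F w (a + s • quadDeriv L B p v) v := by
  obtain ⟨ξ, e, ρ, he, hξ, hG⟩ := h
  have hy : Tendsto (fun k => e k • (ξ k - p)) atTop (𝓝 v) := by
    have := hξ.sub (he.smul_const p)
    simpa [smul_sub] using this
  have hD : Tendsto (fun k => quadDeriv L B p (e k • (ξ k - p))) atTop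
      (𝓝 (quadDeriv L B p v)) :=
    ((LinearMap.continuous_of_finiteDimensional (quadDeriv L B p)).tendsto v).comp hy
  have hτ : Tendsto (fun k => 1 - s * e k) atTop (𝓝 1) := by
    simpa using (he.const_mul s).const_sub 1
  refine ⟨fun k => p + (1 - s * e k) • (ξ k - p), e, fun k => (1 - s * e k) ^ 2 * ρ k, he, ?_, ?_⟩
  · have := (he.smul_const p).add (hτ.smul hy)
    simp only [zero_smul, zero_add, one_smul] at this
    refine this.congr fun k => ?_
    module
  · have := (((hτ.pow 2).smul hG).add (((hτ.pow 2).const_sub 1).smul_const (F p))).add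
      (hτ.smul (hD.const_smul s))
    simp only [one_pow, one_smul, sub_self, zero_smul, add_zero] at this
    refine this.congr fun k => ?_
    have h1 := quadMap_add_smul hF p (ξ k - p) 1
    have h2 := quadMap_add_smul hF p (ξ k - p) (1 - s * e k)
    have h3 : B (ξ k - p) (ξ k - p) = F (ξ k) - F p - quadDeriv L B p (ξ k - p) := by
      rw [one_smul, add_sub_cancel] at h1
      rw [h1]
      module
    rw [h2, h3, map_smul]
    module

/-- The quadratic part vanishes at directions along which `F` stays bounded. -/
theorem AsymptoticAlong.quadratic_part_eq_zero (hF : ∀ x, F x = c + L x + B x x)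
    {a v : Fin n → ℂ} (h : AsymptoticAlong F 0 a v) : B v v = 0 := by
  obtain ⟨ξ, e, ρ, he, hξ, hG⟩ := h
  have hB : ∀ x, B x x = F x - c - L x := fun x => by rw [hF]; module
  have hL : Continuous L := L.continuous_of_finiteDimensional
  have hcont : Continuous fun x => B x x := by
    simp only [hB]
    have := continuous_quadMap hF
    fun_prop
  have h1 := (hcont.tendsto v).comp hξ
  simp only [smul_zero, sub_zero] at hG
  have h2 : Tendsto (fun k => e k ^ 2 • (F (ξ k) - c) - e k • L (e k • ξ k)) atTop
      (𝓝 ((0 : ℂ) ^ 2 • (a - c) - (0 : ℂ) • L v)) :=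
    ((he.pow 2).smul (hG.sub_const c)).sub (he.smul ((hL.tendsto v).comp hξ))
  simp only [ne_eq, OfNat.ofNat_ne_zero, not_false_eq_true, zero_pow, zero_smul, sub_zero] at h2
  refine tendsto_nhds_unique h1 (h2.congr fun k => ?_)
  have hBe : B (e k • ξ k) (e k • ξ k) = e k ^ 2 • B (ξ k) (ξ k) := by
    simp only [map_smul, LinearMap.smul_apply]
    module
  rw [Function.comp_apply, hBe, hB, map_smul]
  module

/-- If every differential maps `u` into the line of `w`, all values of `F` are asymptotic values
modulo `w` along `u`. -/
theorem asymptoticAlong_of_quadDeriv_mem_line (hF : ∀ x, F x = c + L x + B x x)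
    {w u : Fin n → ℂ} (h : ∀ p, ∃ r : ℂ, quadDeriv L B p u = r • w) (p : Fin n → ℂ) :
    AsymptoticAlong F w (F p) u := by
  obtain ⟨r₀, h₀⟩ := h p
  obtain ⟨r₁, h₁⟩ := h u
  obtain ⟨r₂, h₂⟩ := h 0
  have hq : B u u = ((r₁ - r₂) / 2) • w := by
    have : (2 : ℂ) • B u u = (r₁ - r₂) • w := by
      rw [sub_smul, ← h₁, ← h₂]
      simp [quadDeriv]
      module
    rw [div_eq_inv_mul, mul_smul, ← this, smul_smul]
    simp
  refine ⟨fun k => p + (k : ℂ) • u, fun k => (k : ℂ)⁻¹,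
    fun k => k * r₀ + (k : ℂ) ^ 2 * ((r₁ - r₂) / 2), tendsto_inv_atTop_nhds_zero_nat, ?_, ?_⟩
  · have := (tendsto_inv_atTop_nhds_zero_nat (𝕜 := ℂ)).smul_const p |>.add_const u
    simp only [zero_smul, zero_add] at this
    refine this.congr' ?_
    filter_upwards [eventually_gt_atTop 0] with k hk
    rw [smul_add, smul_smul, inv_mul_cancel₀ (by exact_mod_cast hk.ne'), one_smul]
  · refine tendsto_const_nhds.congr fun k => ?_
    rw [quadMap_add_smul hF, h₀, hq]
    module

end QuadraticMaps

section QuadraticMaps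

open MvPolynomial (eval)

variable {n : ℕ} {F : (Fin n → ℂ) → (Fin n → ℂ)} {c : Fin n → ℂ}
  {L : (Fin n → ℂ) →ₗ[ℂ] (Fin n → ℂ)}
  {B : (Fin n → ℂ) →ₗ[ℂ] (Fin n → ℂ) →ₗ[ℂ] (Fin n → ℂ)}

theorem quadDeriv_apply_eq (p y : Fin n → ℂ) :
    quadDeriv L B p y = L y + (B p y + B y p) := by
  simp [quadDeriv, add_assoc]

/-- If `F` moves only in the direction `w` along the lines parallel to `v`, asymptotic values
modulo `w` along a direction transverse to `v` are asymptotic values. -/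
theorem AsymptoticAlong.mem_asymptoticSet_of_lines (hF : ∀ x, F x = c + L x + B x x)
    {v w : Fin n → ℂ} {f : (Fin n → ℂ) →ₗ[ℂ] ℂ}
    (hline : ∀ p (x : ℂ), F (p + x • v) = F p + (x * f (quadDeriv L B p v)) • w)
    {p₀ : Fin n → ℂ} (hp₀ : f (quadDeriv L B p₀ v) ≠ 0)
    {Φ : (Fin n → ℂ) →L[ℂ] (Fin n → ℂ)} (hΦv : Φ v = 0)
    {a u : Fin n → ℂ} (hΦu : Φ u ≠ 0) (h : AsymptoticAlong F w a u) :
    a ∈ asymptoticSet F := by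
  obtain ⟨ξ, e, ρ, he, hξ, hG⟩ := h
  have hcF := continuous_quadMap hF
  have hnear : ∀ k : ℕ, ∃ ζ, f (quadDeriv L B ζ v) ≠ 0 ∧
      ‖e k • ζ - e k • ξ k‖ < 1 / ((k : ℝ) + 1) ∧ ‖F ζ - F (ξ k)‖ < 1 / ((k : ℝ) + 1) := by
    intro k
    have hk : (0 : ℝ) < 1 / ((k : ℝ) + 1) := by positivity
    by_cases h0 : f (quadDeriv L B (ξ k) v) = 0
    · have h1 : Tendsto (fun δ : ℂ => ‖e k • (ξ k + δ • (p₀ - ξ k)) - e k • ξ k‖) (𝓝[≠] 0)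
          (𝓝 0) := by
        refine tendsto_nhdsWithin_of_tendsto_nhds ?_
        have : Continuous fun δ : ℂ => ‖e k • (ξ k + δ • (p₀ - ξ k)) - e k • ξ k‖ := by fun_prop
        simpa using this.tendsto 0
      have h2 : Tendsto (fun δ : ℂ => ‖F (ξ k + δ • (p₀ - ξ k)) - F (ξ k)‖) (𝓝[≠] 0)
          (𝓝 0) := by
        refine tendsto_nhdsWithin_of_tendsto_nhds ?_
        have : Continuous fun δ : ℂ => ‖F (ξ k + δ • (p₀ - ξ k)) - F (ξ k)‖ := by fun_prop
        simpa using this.tendsto 0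
      obtain ⟨δ, hδ1, hδ2, hδ0⟩ := ((h1.eventually (gt_mem_nhds hk)).and
        ((h2.eventually (gt_mem_nhds hk)).and self_mem_nhdsWithin)).exists
      refine ⟨ξ k + δ • (p₀ - ξ k), ?_, hδ1, hδ2⟩
      have : quadDeriv L B (ξ k + δ • (p₀ - ξ k)) v =
          (1 - δ) • quadDeriv L B (ξ k) v + δ • quadDeriv L B p₀ v := by
        simp only [quadDeriv_apply_eq, map_add, map_smul, map_sub, LinearMap.add_apply,
          LinearMap.smul_apply, LinearMap.sub_apply]
        module
      rw [this, map_add, map_smul, map_smul, h0, smul_zero, zero_add]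
      exact smul_ne_zero hδ0 hp₀
    · exact ⟨ξ k, h0, by simpa using hk, by simpa using hk⟩
  choose ζ hζ0 hζ1 hζ2 using hnear
  have hζe : Tendsto (fun k => e k • ζ k) atTop (𝓝 u) := by
    have h1 : Tendsto (fun k => e k • ζ k - e k • ξ k) atTop (𝓝 0) :=
      squeeze_zero_norm (fun k => (hζ1 k).le) tendsto_one_div_add_atTop_nhds_zero_nat
    simpa using h1.add hξ
  have hζF : Tendsto (fun k => F (ζ k) - ρ k • w) atTop (𝓝 a) := by
    have h1 : Tendsto (fun k => F (ζ k) - F (ξ k)) atTop (𝓝 0) :=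
      squeeze_zero_norm (fun k => (hζ2 k).le) tendsto_one_div_add_atTop_nhds_zero_nat
    simpa using h1.add hG
  refine ⟨fun k => ζ k + (-ρ k / f (quadDeriv L B (ζ k) v)) • v, ?_, ?_⟩
  · have h1 : Tendsto (fun k => e k • Φ (ζ k)) atTop (𝓝 (Φ u)) := by
      have := (Φ.continuous.tendsto u).comp hζe
      exact this.congr fun k => by simp
    have h2 := tendsto_norm_atTop_of_tendsto_smul he h1 hΦu
    have h3 : Tendsto (fun k => ‖Φ (ζ k)‖ / (‖Φ‖ + 1)) atTop atTop :=
      h2.atTop_div_const (by positivity)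
    refine tendsto_atTop_mono (fun k => ?_) h3
    rw [div_le_iff₀ (by positivity)]
    have h4 := Φ.le_opNorm (ζ k + (-ρ k / f (quadDeriv L B (ζ k) v)) • v)
    rw [map_add, map_smul, hΦv, smul_zero, add_zero] at h4
    nlinarith [norm_nonneg (ζ k + (-ρ k / f (quadDeriv L B (ζ k) v)) • v)]
  · refine hζF.congr fun k => ?_
    rw [hline, div_mul_cancel₀ _ (hζ0 k)]
    module

theorem exists_dual_vanishing_pair (x y : Fin 3 → ℂ) :
    ∃ f : (Fin 3 → ℂ) →ₗ[ℂ] ℂ, f ≠ 0 ∧ f x = 0 ∧ f y = 0 := by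
  have hlt : Submodule.span ℂ (Set.range ![x, y]) < ⊤ := by
    refine lt_top_iff_ne_top.2 fun htop => ?_
    have := finrank_range_le_card (R := ℂ) ![x, y]
    rw [Set.finrank, htop] at this
    simp at this
  obtain ⟨f, hf0, hf⟩ := Submodule.exists_le_ker_of_lt_top _ hlt
  exact ⟨f, hf0, hf (Submodule.subset_span ⟨0, rfl⟩), hf (Submodule.subset_span ⟨1, rfl⟩)⟩

theorem exists_span_ker_pair {f : (Fin 3 → ℂ) →ₗ[ℂ] ℂ} (hf : f ≠ 0) {v : Fin 3 → ℂ}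
    (hv : v ≠ 0) (hfv : f v = 0) :
    ∃ e, f e = 0 ∧ ∀ x, f x = 0 → ∃ t s : ℂ, x = t • v + s • e := by
  have hker : Module.finrank ℂ (LinearMap.ker f) = 2 := by
    have h1 := LinearMap.finrank_range_add_finrank_ker f
    have h2 : LinearMap.range f = ⊤ := LinearMap.range_eq_top.2 (LinearMap.surjective hf)
    rw [h2] at h1
    simp at h1
    omega
  obtain ⟨e, he, hev⟩ : ∃ e, f e = 0 ∧ ∀ r : ℂ, r • v ≠ e := by
    by_contra! h
    have : LinearMap.ker f ≤ Submodule.span ℂ {v} := fun x hx =>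
      Submodule.mem_span_singleton.2 (h x hx)
    have := Submodule.finrank_mono this
    rw [hker, finrank_span_singleton hv] at this
    omega
  refine ⟨e, he, fun x hx => ?_⟩
  have hli : LinearIndependent ℂ ![e, v] := linearIndependent_fin2.2 ⟨hv, hev⟩
  have hspan : Submodule.span ℂ (Set.range ![e, v]) = LinearMap.ker f := by
    refine Submodule.eq_of_le_of_finrank_le ?_ ?_
    · rw [Submodule.span_le]
      rintro _ ⟨i, rfl⟩
      fin_cases i
      · exact he
      · exact hfv
    · rw [hker, finrank_span_eq_card hli]
      simp
  have hmem : x ∈ Submodule.span ℂ (Set.range ![e, v]) := hspan ▸ hx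
  simp only [Matrix.range_cons, Matrix.range_empty, Set.union_empty, Set.singleton_union,
    Submodule.mem_span_pair] at hmem
  obtain ⟨s, t, hst⟩ := hmem
  exact ⟨t, s, by rw [← hst, add_comm]⟩

end QuadraticMaps

section QuadraticMaps

open MvPolynomial (eval)

variable {F : (Fin 3 → ℂ) → (Fin 3 → ℂ)} {c : Fin 3 → ℂ}
  {L : (Fin 3 → ℂ) →ₗ[ℂ] (Fin 3 → ℂ)}
  {B : (Fin 3 → ℂ) →ₗ[ℂ] (Fin 3 → ℂ) →ₗ[ℂ] (Fin 3 → ℂ)}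

/-- A point of the asymptotic set through which no plane of asymptotic values passes is, modulo
the direction `w`, the value of `F` at a point where `F` is constant along `v`. -/
theorem exists_eq_add_smul_of_mem_asymptoticSet (hF : ∀ x, F x = c + L x + B x x)
    (hnot : ∃ p, F p ∉ asymptoticSet F)
    {v w : Fin 3 → ℂ} (hv : v ≠ 0) (hw : w ≠ 0) {f : (Fin 3 → ℂ) →ₗ[ℂ] ℂ} (hfw : f w = 1)
    (hline : ∀ p (x : ℂ), F (p + x • v) = F p + (x * f (quadDeriv L B p v)) • w)
    {p₀ : Fin 3 → ℂ} (hp₀ : f (quadDeriv L B p₀ v) ≠ 0)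
    {a : Fin 3 → ℂ} (ha : a ∈ asymptoticSet F)
    (hplane : ∀ w₁ w₂, LinearIndependent ℂ ![w₁, w₂] →
      ¬∀ s t : ℂ, a + s • w₁ + t • w₂ ∈ asymptoticSet F) :
    ∃ (η : Fin 3 → ℂ) (ρ : ℂ), f (quadDeriv L B η v) = 0 ∧ a = F η + ρ • w := by
  obtain ⟨i, hi⟩ : ∃ i, v i ≠ 0 := Function.ne_iff.1 hv
  let Φ : (Fin 3 → ℂ) →L[ℂ] (Fin 3 → ℂ) := LinearMap.toContinuousLinearMap
    (LinearMap.id - ((v i)⁻¹ • LinearMap.proj (R := ℂ) (φ := fun _ => ℂ) i).smulRight v)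
  have hΦ : ∀ x, Φ x = x - ((v i)⁻¹ * x i) • v := fun x => rfl
  have hΦv : Φ v = 0 := by rw [hΦ, inv_mul_cancel₀ hi]; module
  have hΦΦ : ∀ x, Φ (Φ x) = Φ x := fun x => by
    conv_lhs => rw [hΦ x]
    rw [map_sub, map_smul, hΦv, smul_zero, sub_zero]
  obtain ⟨ξ, hξ, hFξ⟩ := ha
  have hsplit : ∀ k, ξ k = Φ (ξ k) + ((v i)⁻¹ * ξ k i) • v := fun k => by rw [hΦ]; module
  have hFsplit : ∀ k, F (ξ k) = F (Φ (ξ k)) +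
      ((v i)⁻¹ * ξ k i * f (quadDeriv L B (Φ (ξ k)) v)) • w := fun k => by
    conv_lhs => rw [hsplit k, hline]
  have hℓc : Continuous fun p => f (quadDeriv L B p v) := by
    have h1 : Continuous f := f.continuous_of_finiteDimensional
    have h2 : Continuous (B.flip v) := LinearMap.continuous_of_finiteDimensional _
    have h3 : Continuous (B v) := LinearMap.continuous_of_finiteDimensional _
    have h4 : ∀ p, quadDeriv L B p v = L v + (B.flip v p + B v p) := fun p => by
      rw [quadDeriv_apply_eq, LinearMap.flip_apply]
    simp only [h4]
    fun_prop
  by_cases hbd : ∃ M : ℝ, ∃ᶠ k in atTop, Φ (ξ k) ∈ Metric.ball (0 : Fin 3 → ℂ) M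
  · obtain ⟨M, hM⟩ := hbd
    obtain ⟨η, -, φ, hφ, hη⟩ := tendsto_subseq_of_frequently_bounded Metric.isBounded_ball hM
    have hFη := ((continuous_quadMap hF).tendsto η).comp hη
    have hFξφ := hFξ.comp hφ.tendsto_atTop
    have hprod : Tendsto (fun k => ((v i)⁻¹ * ξ (φ k) i *
        f (quadDeriv L B (Φ (ξ (φ k))) v)) • w) atTop (𝓝 (a - F η)) := by
      refine (hFξφ.sub hFη).congr fun k => ?_
      simp only [Function.comp_apply]
      conv_lhs => rw [hFsplit]
      module
    have hscal : Tendsto (fun k => (v i)⁻¹ * ξ (φ k) i *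
        f (quadDeriv L B (Φ (ξ (φ k))) v)) atTop (𝓝 (f (a - F η))) := by
      have h1 : Continuous f := f.continuous_of_finiteDimensional
      refine ((h1.tendsto _).comp hprod).congr fun k => ?_
      simp [hfw]
    have hℓη := (hℓc.tendsto η).comp hη
    refine ⟨η, f (a - F η), ?_, ?_⟩
    · by_contra hne
      have hx : Tendsto (fun k => (v i)⁻¹ * ξ (φ k) i) atTop
          (𝓝 (f (a - F η) / f (quadDeriv L B η v))) := by
        refine (hscal.div hℓη hne).congr' ?_
        filter_upwards [hℓη.eventually_ne hne] with k hk
        simp only [Function.comp_apply] at hk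
        simp only [Function.comp_apply, Pi.div_apply]
        rw [mul_div_assoc, div_self hk, mul_one]
      have hξc := hη.add (hx.smul_const v)
      refine not_tendsto_nhds_of_tendsto_atTop (hξ.comp hφ.tendsto_atTop) _
        (hξc.norm.congr fun k => ?_)
      simp only [Function.comp_apply]
      rw [← hsplit]
    · have := tendsto_nhds_unique hprod (hscal.smul_const w)
      rw [← this]
      module
  · exfalso
    push Not at hbd
    have hη : Tendsto (fun k => ‖Φ (ξ k)‖) atTop atTop := by
      refine tendsto_atTop.2 fun M => (hbd M).mono fun k hk => ?_
      simpa using hk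
    obtain ⟨φ, e, u, hφ, hu, he, heu⟩ := exists_subseq_direction hη
    have hΦu : Φ u ≠ 0 := by
      have h1 := (Φ.continuous.tendsto u).comp heu
      have h2 := tendsto_nhds_unique (h1.congr fun k => by simp [hΦΦ]) heu
      rwa [h2]
    have halong : AsymptoticAlong F w a u := by
      refine ⟨fun k => Φ (ξ (φ k)), e, fun k => -((v i)⁻¹ * ξ (φ k) i *
        f (quadDeriv L B (Φ (ξ (φ k))) v)), he, heu,
        (hFξ.comp hφ.tendsto_atTop).congr fun k => ?_⟩
      rw [Function.comp_apply, hFsplit]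
      module
    have hlift : ∀ b, AsymptoticAlong F w b u → b ∈ asymptoticSet F := fun b hb =>
      hb.mem_asymptoticSet_of_lines hF hline hp₀ hΦv hΦu
    obtain ⟨p, hp⟩ : ∃ p, ∀ r : ℂ, r • w ≠ quadDeriv L B p u := by
      by_contra! h
      obtain ⟨q, hq⟩ := hnot
      exact hq (hlift _ (asymptoticAlong_of_quadDeriv_mem_line hF
        (fun p => (h p).imp fun r hr => hr.symm) q))
    exact hplane (quadDeriv L B p u) w (linearIndependent_fin2.2 ⟨hw, hp⟩) fun s t =>
      hlift _ ((halong.add_smul_quadDeriv hF p s).add_smul t)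

/-- An irreducible quadric contained in the asymptotic set of a dominant quadratic mapping of
`ℂ³` has a quadratic part of rank at most one. -/
theorem exists_parabolic_form_of_quadric_subset (hF : ∀ x, F x = c + L x + B x x)
    {R Q : MvPolynomial (Fin 3) ℂ} (hR : R ≠ 0)
    (hRF : ∀ a ∈ asymptoticSet F, eval a R = 0) (hdom : Dense (Set.range F))
    (hQ : Irreducible Q) (hdeg : Q.totalDegree = 2)
    (hsub : ∀ a, eval a Q = 0 → a ∈ asymptoticSet F) :
    ∃ (g h : (Fin 3 → ℂ) →ₗ[ℂ] ℂ) (α β γ d : ℂ), g ≠ 0 ∧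
      ∀ x, g x + α * (h x - β) ^ 2 - γ = d * eval x Q := by
  obtain ⟨R', ⟨a₀, ha₀Q, ha₀⟩, hdvd, hlines⟩ := exists_generic_locus hQ hR
  have hnot : ∃ p, F p ∉ asymptoticSet F := by
    by_contra! h
    refine hR (eq_zero_of_eval_dense hdom ?_)
    rintro _ ⟨p, rfl⟩
    exact hRF _ (h p)
  have hplane : ∀ a, eval a R' ≠ 0 → ∀ w₁ w₂, LinearIndependent ℂ ![w₁, w₂] →
      ¬∀ s t : ℂ, a + s • w₁ + t • w₂ ∈ asymptoticSet F := by
    intro a ha w₁ w₂ hw h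
    obtain ⟨s, t, hst⟩ := not_plane_subset_zeros hQ hdeg hw a
    have := hlines a (s • w₁ + t • w₂) ha (fun r => hRF _ (by
      have := h (r * s) (r * t)
      rwa [mul_smul, mul_smul, add_assoc, ← smul_add] at this)) 1
    rw [one_smul, ← add_assoc] at this
    exact hst this
  obtain ⟨v, hv, hav⟩ : ∃ v, v ≠ 0 ∧ AsymptoticAlong F 0 a₀ v := by
    obtain ⟨ξ, hξ, hFξ⟩ := hsub a₀ ha₀Q
    obtain ⟨φ, e, v, hφ, hv, he, hev⟩ := exists_subseq_direction hξ
    exact ⟨v, hv, ξ ∘ φ, e, 0, he, hev, by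
      simpa [Function.comp_def] using hFξ.comp hφ.tendsto_atTop⟩
  have hBv := hav.quadratic_part_eq_zero hF
  obtain ⟨p₀, hp₀⟩ : ∃ p, quadDeriv L B p v ≠ 0 := by
    by_contra! h
    obtain ⟨q, hq⟩ := hnot
    exact hq ((asymptoticAlong_of_quadDeriv_mem_line hF
      (fun p => ⟨0, by rw [h, smul_zero]⟩) q).mem_asymptoticSet hv)
  set w := quadDeriv L B p₀ v with hw
  have hmul : ∀ p, ∃ r : ℂ, r • w = quadDeriv L B p v := by
    intro p
    by_contra! h
    exact hplane a₀ ha₀ _ w (linearIndependent_fin2.2 ⟨hp₀, h⟩) fun s t =>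
      ((hav.add_smul_quadDeriv hF p s).add_smul_quadDeriv hF p₀ t).mem_asymptoticSet hv
  obtain ⟨f, hfw⟩ : ∃ f : (Fin 3 → ℂ) →ₗ[ℂ] ℂ, f w = 1 := by
    obtain ⟨i, hi⟩ : ∃ i, w i ≠ 0 := Function.ne_iff.1 hp₀
    exact ⟨(w i)⁻¹ • LinearMap.proj (R := ℂ) (φ := fun _ => ℂ) i, by simp [hi]⟩
  have hDf : ∀ p, quadDeriv L B p v = f (quadDeriv L B p v) • w := by
    intro p
    obtain ⟨r, hr⟩ := hmul p
    rw [← hr, map_smul, hfw, smul_eq_mul, mul_one]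
  have hline : ∀ p (x : ℂ), F (p + x • v) = F p + (x * f (quadDeriv L B p v)) • w := by
    intro p x
    rw [quadMap_add_smul hF, hBv, mul_smul, ← hDf]
    module
  have hgen : ∀ a, eval a Q = 0 → eval a R' ≠ 0 →
      ∃ (η : Fin 3 → ℂ) (ρ : ℂ), f (quadDeriv L B η v) = 0 ∧ a = F η + ρ • w := fun a h₁ h₂ =>
    exists_eq_add_smul_of_mem_asymptoticSet hF hnot hv hp₀ hfw hline
      (p₀ := p₀) (by rw [← hw, hfw]; exact one_ne_zero) (hsub a h₁) (hplane a h₂)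
  obtain ⟨η₀, -, hη₀, -⟩ := hgen a₀ ha₀Q ha₀
  let Λ : (Fin 3 → ℂ) →ₗ[ℂ] ℂ := f ∘ₗ (B.flip v + B v)
  have hΛ : ∀ p q, f (quadDeriv L B (p + q) v) = f (quadDeriv L B p v) + Λ q := by
    intro p q
    simp only [quadDeriv_apply_eq, map_add, LinearMap.add_apply, LinearMap.comp_apply, Λ,
      LinearMap.flip_apply]
    ring
  have hΛv : Λ v = 0 := by simp [Λ, hBv]
  have hΛ0 : Λ ≠ 0 := by
    intro h0
    have := hΛ η₀ (p₀ - η₀)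
    rw [add_sub_cancel, hη₀, h0, ← hw, hfw] at this
    simp at this
  obtain ⟨e, he, hspan⟩ := exists_span_ker_pair hΛ0 hv hΛv
  have hparam : ∀ a, eval a Q = 0 → eval a R' ≠ 0 → ∃ s ρ : ℂ,
      a = F η₀ + s • quadDeriv L B η₀ e + s ^ 2 • B e e + ρ • w := by
    intro a h₁ h₂
    obtain ⟨η, ρ, hη, rfl⟩ := hgen a h₁ h₂
    have h3 := hΛ η₀ (η - η₀)
    rw [add_sub_cancel, hη, hη₀, zero_add] at h3
    obtain ⟨t, s, hts⟩ := hspan _ h3.symm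
    refine ⟨s, ρ, ?_⟩
    have h4 : η = η₀ + s • e + t • v := by
      rw [add_assoc, add_comm (s • e), ← hts, add_sub_cancel]
    rw [h4, hline, hΛ, hη₀, map_smul, he, quadMap_add_smul hF]
    simp
  have hconcl : ∀ (g h : (Fin 3 → ℂ) →ₗ[ℂ] ℂ) (α β γ : ℂ), g ≠ 0 →
      (∀ a, eval a Q = 0 → eval a R' ≠ 0 → g a + α * (h a - β) ^ 2 - γ = 0) →
      ∃ (g h : (Fin 3 → ℂ) →ₗ[ℂ] ℂ) (α β γ d : ℂ), g ≠ 0 ∧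
        ∀ x, g x + α * (h x - β) ^ 2 - γ = d * eval x Q := by
    intro g h α β γ hg hvan
    have heval : ∀ x, eval x (linPoly g + MvPolynomial.C α * (linPoly h - MvPolynomial.C β) ^ 2
        - MvPolynomial.C γ) = g x + α * (h x - β) ^ 2 - γ := fun x => by
      simp [eval_linPoly]
    have hle : (linPoly g + MvPolynomial.C α * (linPoly h - MvPolynomial.C β) ^ 2
        - MvPolynomial.C γ).totalDegree ≤ 2 := by
      refine (MvPolynomial.totalDegree_sub_C_le _ _).trans
        ((MvPolynomial.totalDegree_add _ _).trans (max_le ?_ ?_))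
      · exact (totalDegree_linPoly_le g).trans one_le_two
      · refine (MvPolynomial.totalDegree_mul _ _).trans ?_
        rw [MvPolynomial.totalDegree_C, zero_add]
        refine (MvPolynomial.totalDegree_pow _ _).trans ?_
        have := (MvPolynomial.totalDegree_sub_C_le (linPoly h) β).trans (totalDegree_linPoly_le h)
        omega
    obtain ⟨d, hd⟩ := eval_eq_mul_of_dvd hdeg hle
      (hdvd _ fun a h₁ h₂ => by rw [heval]; exact hvan a h₁ h₂)
    exact ⟨g, h, α, β, γ, d, hg, fun x => by rw [← heval, hd]⟩
  obtain ⟨h, hh0, hhw, hhe⟩ := exists_dual_vanishing_pair w (B e e)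
  by_cases hb : h (quadDeriv L B η₀ e) = 0
  · refine hconcl h 0 0 0 (h (F η₀)) hh0 fun a h₁ h₂ => ?_
    obtain ⟨s, ρ, rfl⟩ := hparam a h₁ h₂
    simp [hb, hhw, hhe]
  · obtain ⟨g, hg0, hgw, hgb⟩ := exists_dual_vanishing_pair w (quadDeriv L B η₀ e)
    refine hconcl g h (-g (B e e) / h (quadDeriv L B η₀ e) ^ 2) (h (F η₀)) (g (F η₀)) hg0
      fun a h₁ h₂ => ?_
    obtain ⟨s, ρ, rfl⟩ := hparam a h₁ h₂
    simp only [map_add, map_smul, hgw, hgb, hhw, hhe, smul_eq_mul]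
    field_simp
    ring

end QuadraticMaps

section Diagonal

open MvPolynomial

/-- A polynomial of degree at most two is a constant plus a linear form plus a bilinear form
evaluated on the diagonal. -/
theorem exists_quadratic_form_of_totalDegree_le (p : MvPolynomial (Fin 3) ℂ)
    (hp : p.totalDegree ≤ 2) :
    ∃ (c : ℂ) (L : (Fin 3 → ℂ) →ₗ[ℂ] ℂ) (B : (Fin 3 → ℂ) →ₗ[ℂ] (Fin 3 → ℂ) →ₗ[ℂ] ℂ),
      ∀ x, eval x p = c + L x + B x x := by
  have hmono : ∀ m ∈ p.support, ∃ (c : ℂ) (L : (Fin 3 → ℂ) →ₗ[ℂ] ℂ)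
      (B : (Fin 3 → ℂ) →ₗ[ℂ] (Fin 3 → ℂ) →ₗ[ℂ] ℂ),
      ∀ x, eval x (monomial m (coeff m p)) = c + L x + B x x := by
    intro m hm
    have hdeg : m.degree ≤ 2 := (Finsupp.degree_eq_sum m ▸ (by
      have := (le_totalDegree hm).trans hp
      rwa [Finsupp.sum_fintype _ _ (fun _ => rfl)] at this))
    have key : m = 0 ∨ (∃ i, m = Finsupp.single i 1) ∨
        ∃ i j, m = Finsupp.single i 1 + Finsupp.single j 1 := by
      have hsub : ∀ n : Fin 3 →₀ ℕ, n ≠ 0 → ∃ i n', n = Finsupp.single i 1 + n' ∧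
          n.degree = n'.degree + 1 := by
        intro n hn
        obtain ⟨i, hi⟩ := Finsupp.ne_iff.1 hn
        have hle : Finsupp.single i 1 ≤ n := by
          rw [Finsupp.single_le_iff]
          exact Nat.one_le_iff_ne_zero.2 hi
        refine ⟨i, n - Finsupp.single i 1, (add_tsub_cancel_of_le hle).symm, ?_⟩
        conv_lhs => rw [← add_tsub_cancel_of_le hle, map_add, Finsupp.degree_single]
        ring
      by_cases h0 : m = 0
      · exact Or.inl h0
      obtain ⟨i, n, rfl, hi⟩ := hsub m h0
      by_cases h1 : n = 0
      · exact Or.inr (Or.inl ⟨i, by simp [h1]⟩)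
      obtain ⟨j, k, rfl, hj⟩ := hsub n h1
      have hk : k.degree = 0 := by omega
      rw [Finsupp.degree_eq_zero_iff] at hk
      exact Or.inr (Or.inr ⟨i, j, by simp [hk]⟩)
    rcases key with h | ⟨i, h⟩ | ⟨i, j, h⟩
    · exact ⟨coeff m p, 0, 0, fun x => by rw [eval_monomial]; simp [h]⟩
    · exact ⟨0, coeff m p • LinearMap.proj (R := ℂ) (φ := fun _ => ℂ) i, 0, fun x => by
        rw [eval_monomial]; simp [h]⟩
    · refine ⟨0, 0, coeff m p • (LinearMap.proj (R := ℂ) (φ := fun _ => ℂ) i).smulRight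
        (LinearMap.proj (R := ℂ) (φ := fun _ => ℂ) j), fun x => ?_⟩
      rw [eval_monomial, h, Finsupp.prod_add_index' (by simp) (by simp [pow_add])]
      simp
  choose! c L B h using hmono
  refine ⟨∑ m ∈ p.support, c m, ∑ m ∈ p.support, L m, ∑ m ∈ p.support, B m, fun x => ?_⟩
  conv_lhs => rw [p.as_sum, map_sum]
  rw [Finset.sum_congr rfl fun m hm => h m hm x]
  simp [Finset.sum_add_distrib, LinearMap.sum_apply]

/-- A polynomial mapping of degree two is the sum of a constant, a linear and a quadratic
mapping. -/
theorem exists_quadratic_map {P : Fin 3 → MvPolynomial (Fin 3) ℂ}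
    {F : (Fin 3 → ℂ) → (Fin 3 → ℂ)} (hP : ∀ x i, F x i = eval x (P i))
    (hdeg : ∀ i, (P i).totalDegree ≤ 2) :
    ∃ (c : Fin 3 → ℂ) (L : (Fin 3 → ℂ) →ₗ[ℂ] (Fin 3 → ℂ))
      (B : (Fin 3 → ℂ) →ₗ[ℂ] (Fin 3 → ℂ) →ₗ[ℂ] (Fin 3 → ℂ)), ∀ x, F x = c + L x + B x x := by
  choose c L B h using fun i => exists_quadratic_form_of_totalDegree_le (P i) (hdeg i)
  refine ⟨c, LinearMap.pi L, LinearMap.mk₂ ℂ (fun x y i => B i x y) ?_ ?_ ?_ ?_, fun x => ?_⟩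
  · intros; ext; simp
  · intros; ext; simp
  · intros; ext; simp
  · intros; ext; simp
  · ext i
    rw [hP, h]
    simp

theorem eval_diagonal (r : Fin 3 → ℂ) (p : Fin 3 → ℕ) (r₄ : ℂ) (x : Fin 3 → ℂ) :
    eval x ((∑ i : Fin 3, C (r i) * X i ^ p i) + C r₄) = ∑ i, r i * x i ^ p i + r₄ := by
  simp

/-- The nonconstant terms of a diagonal polynomial have degree at most its total degree. -/
theorem exponent_le_totalDegree_diagonal (r : Fin 3 → ℂ) (p : Fin 3 → ℕ) (r₄ : ℂ) {i : Fin 3}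
    (hi : r i ≠ 0) :
    p i ≤ ((∑ i : Fin 3, C (r i) * X i ^ p i) + C r₄ : MvPolynomial (Fin 3) ℂ).totalDegree := by
  rcases Nat.eq_zero_or_pos (p i) with h0 | hpos
  · rw [h0]; exact Nat.zero_le _
  have hcoeff : coeff (Finsupp.single i (p i))
      ((∑ i : Fin 3, C (r i) * X i ^ p i) + C r₄ : MvPolynomial (Fin 3) ℂ) = r i := by
    rw [coeff_add, coeff_sum, coeff_C, if_neg, add_zero, Finset.sum_eq_single i]
    · simp [coeff_C_mul, X_pow_eq_monomial]
    · intro j _ hj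
      rw [coeff_C_mul, X_pow_eq_monomial, coeff_monomial, if_neg, mul_zero]
      intro h
      have := DFunLike.congr_fun h i
      rw [Finsupp.single_eq_of_ne hj.symm, Finsupp.single_eq_same] at this
      omega
    · simp
    · intro h
      have := DFunLike.congr_fun h i
      simp at this
      omega
  have := le_totalDegree (mem_support_iff.2 (hcoeff ▸ hi))
  simpa using this

/-- A diagonal polynomial of degree two has a term of degree two. -/
theorem exists_quadratic_term {r : Fin 3 → ℂ} {p : Fin 3 → ℕ} {r₄ : ℂ}
    (hdeg : ((∑ i : Fin 3, C (r i) * X i ^ p i) + C r₄ :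
      MvPolynomial (Fin 3) ℂ).totalDegree = 2) : ∃ i, r i ≠ 0 ∧ p i = 2 := by
  by_contra! h
  have hterm : ∀ i : Fin 3, (C (r i) * X i ^ p i : MvPolynomial (Fin 3) ℂ).totalDegree ≤ 1 := by
    intro i
    by_cases hi : r i = 0
    · simp [hi]
    · have h2 := exponent_le_totalDegree_diagonal r p r₄ hi
      have := h i hi
      refine (totalDegree_mul _ _).trans ?_
      rw [totalDegree_C, totalDegree_X_pow]
      omega
  have := (totalDegree_add (∑ i : Fin 3, C (r i) * X i ^ p i) (C r₄)).trans
    (max_le (totalDegree_finsetSum_le (s := Finset.univ) fun i _ => hterm i)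
      (by rw [totalDegree_C]; exact Nat.zero_le 1))
  omega

/-- Two distinct indices of `Fin 3` determine a third one. -/
theorem exists_third_index {i j : Fin 3} (hij : i ≠ j) :
    ∃ k, i ≠ k ∧ j ≠ k ∧ ∀ f : Fin 3 → ℂ, ∑ m, f m = f i + f j + f k := by
  obtain ⟨k, hik, hjk, huniv⟩ : ∃ k, i ≠ k ∧ j ≠ k ∧
      Finset.univ = ({i, j, k} : Finset (Fin 3)) := by
    revert i j
    decide
  refine ⟨k, hik, hjk, fun f => ?_⟩
  rw [huniv, Finset.sum_insert (by simp [hij, hik]), Finset.sum_pair hjk, add_assoc]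

/-- If a polynomial function of parabolic form is proportional to a diagonal one, then at most
one square occurs in the latter. -/
theorem quadratic_index_unique {r : Fin 3 → ℂ} {p : Fin 3 → ℕ} {r₄ : ℂ}
    {g h : (Fin 3 → ℂ) →ₗ[ℂ] ℂ} {α β γ d : ℂ} (hg : g ≠ 0)
    (hform : ∀ x, g x + α * (h x - β) ^ 2 - γ = d * (∑ i, r i * x i ^ p i + r₄))
    {i j : Fin 3} (hi : r i ≠ 0) (hpi : p i = 2) (hj : r j ≠ 0) (hpj : p j = 2) : i = j := by
  by_contra hij
  obtain rfl | hd := eq_or_ne d 0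
  · refine hg (LinearMap.ext fun x => ?_)
    have h0 := hform 0
    have h1 := hform x
    have h2 := hform (-x)
    simp only [map_zero, map_neg, zero_mul] at h0 h1 h2
    have h3 : α * h x ^ 2 = 0 := by linear_combination (h1 + h2) / 2 - h0
    rcases mul_eq_zero.1 h3 with h4 | h4
    · simp only [h4, LinearMap.zero_apply] at *
      linear_combination h1 - h0
    · rw [sq_eq_zero_iff] at h4
      rw [h4] at h1
      rw [LinearMap.zero_apply]
      linear_combination h1 - h0
  · obtain ⟨k, hik, hjk, hsum⟩ := exists_third_index hij
    have hval : ∀ a b : ℂ, a * g (Pi.single i 1) + b * g (Pi.single j 1) +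
        α * (a * h (Pi.single i 1) + b * h (Pi.single j 1) - β) ^ 2 - γ =
        d * (r i * a ^ 2 + r j * b ^ 2 + r k * 0 ^ p k + r₄) := by
      intro a b
      have := hform (a • Pi.single i 1 + b • Pi.single j 1)
      rw [hsum] at this
      simpa [hpi, hpj, hij, hik.symm, hjk.symm, Ne.symm hij] using this
    have h00 := hval 0 0
    have h10 := hval 1 0
    have h10' := hval (-1) 0
    have h01 := hval 0 1
    have h01' := hval 0 (-1)
    have h11 := hval 1 1
    have hii : α * h (Pi.single i 1) ^ 2 = d * r i := by
      linear_combination (h10 + h10') / 2 - h00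
    have hjj : α * h (Pi.single j 1) ^ 2 = d * r j := by
      linear_combination (h01 + h01') / 2 - h00
    have hmix : α * (h (Pi.single i 1) * h (Pi.single j 1)) = 0 := by
      linear_combination (h11 - h10 - h01 + h00) / 2
    have : (d * r i) * (d * r j) = 0 := by
      rw [← hii, ← hjj]
      linear_combination (α * (h (Pi.single i 1) * h (Pi.single j 1))) * hmix
    exact mul_ne_zero (mul_ne_zero hd hi) (mul_ne_zero hd hj) this

/-- A quadratic polynomial in one of the variables without linear term is reducible. -/
theorem not_irreducible_C_mul_X_sq_add_C (i : Fin 3) {a : ℂ} (ha : a ≠ 0) (b : ℂ) :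
    ¬Irreducible (C a * X i ^ 2 + C b : MvPolynomial (Fin 3) ℂ) := by
  intro hirr
  obtain ⟨δ, hδ⟩ := IsAlgClosed.exists_pow_nat_eq (-b / a) two_pos
  have hb : b = -(a * δ ^ 2) := by rw [hδ]; field_simp
  have hX : ∀ c : ℂ, ¬IsUnit (X i + C c : MvPolynomial (Fin 3) ℂ) := fun c hc => by
    have := hc.map (eval fun _ => -c)
    simp at this
  have hfac : (C a * X i ^ 2 + C b : MvPolynomial (Fin 3) ℂ) =
      (C a * (X i + C δ)) * (X i + C (-δ)) := by
    rw [hb]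
    simp only [map_neg, map_mul, map_pow]
    ring
  rcases hirr.isUnit_or_isUnit hfac with h | h
  · exact hX _ (isUnit_of_mul_isUnit_right h)
  · exact hX _ h

end Diagonal

/-- If `S_F` contains the zero set `Z` of an irreducible degree-2 polynomial of diagonal form
`r₁·x₁^{p₁} + r₂·x₂^{p₂} + r₃·x₃^{p₃} + r₄`, then there is exactly one index `i` with
`r i ≠ 0` and `p i = 2`, there is an index `j ≠ i` with `r j ≠ 0` and `p j = 1`,
and `Z` is a paraboloid. -/
theorem diagonal_degree_two_surface_is_paraboloid
    (P : Fin 3 → MvPolynomial (Fin 3) ℂ) (F : (Fin 3 → ℂ) → (Fin 3 → ℂ))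
    (hP : IsDegTwoPolyMap P F)
    (hdom : Dense (Set.range F))
    (hne : asymptoticSet F ≠ ∅)
    (r : Fin 3 → ℂ) (p : Fin 3 → ℕ) (r₄ : ℂ)
    (Q : MvPolynomial (Fin 3) ℂ)
    (hQ : Q = (∑ i : Fin 3, MvPolynomial.C (r i) * MvPolynomial.X i ^ (p i)) +
      MvPolynomial.C r₄)
    (hQirr : Irreducible Q) (hQdeg : Q.totalDegree = 2)
    (Z : Set (Fin 3 → ℂ)) (hZ : Z = {x | MvPolynomial.eval x Q = 0})
    (hZsub : Z ⊆ asymptoticSet F) :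
    (∃ i : Fin 3, (r i ≠ 0 ∧ p i = 2) ∧
      (∀ i' : Fin 3, r i' ≠ 0 ∧ p i' = 2 → i' = i) ∧
      (∃ j : Fin 3, j ≠ i ∧ r j ≠ 0 ∧ p j = 1)) ∧
    IsParaboloid Z := by
  obtain ⟨hFP, hPdeg, -⟩ := hP
  obtain ⟨c, L, B, hF⟩ := exists_quadratic_map hFP hPdeg
  obtain ⟨R, hR, hRF⟩ := exists_ne_zero_vanishing_on_asymptoticSet hFP hdom
  obtain ⟨g, h, α, β, γ, d, hg, hform⟩ := exists_parabolic_form_of_quadric_subset hF hR hRF hdom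
    hQirr hQdeg fun a ha => hZsub (hZ ▸ ha)
  subst hQ
  simp only [eval_diagonal] at hform hZ
  obtain ⟨i, hi, hpi⟩ := exists_quadratic_term hQdeg
  have huniq : ∀ j, r j ≠ 0 ∧ p j = 2 → j = i := fun j hj =>
    quadratic_index_unique hg hform hj.1 hj.2 hi hpi
  have hcases : ∀ j, j ≠ i → r j = 0 ∨ p j = 0 ∨ p j = 1 := by
    intro j hj
    by_contra! hne'
    have := exponent_le_totalDegree_diagonal r p r₄ hne'.1
    exact hj (huniq j ⟨hne'.1, by omega⟩)
  obtain ⟨j, hij, hj, hpj⟩ : ∃ j, j ≠ i ∧ r j ≠ 0 ∧ p j = 1 := by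
    by_contra! hno
    refine not_irreducible_C_mul_X_sq_add_C i hi (∑ j ∈ Finset.univ.erase i, r j + r₄) ?_
    convert hQirr using 1
    rw [← Finset.add_sum_erase _ _ (Finset.mem_univ i), hpi, map_add, map_sum, add_assoc]
    congr 2
    refine Finset.sum_congr rfl fun j hj => ?_
    rw [Finset.mem_erase] at hj
    rcases hcases j hj.1 with h0 | h0 | h0
    · simp [h0]
    · simp [h0]
    · have : r j = 0 := by
        by_contra hrj
        exact hno j hj.1 hrj h0
      simp [this]
  refine ⟨⟨i, ⟨hi, hpi⟩, huniq, j, hij, hj, hpj⟩, ?_⟩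
  obtain ⟨k, hik, hjk, hsum⟩ := exists_third_index hij.symm
  obtain ⟨t, u, htu⟩ : ∃ t u : ℂ, ∀ y : ℂ, r k * y ^ p k = t * y + u := by
    rcases hcases k hik.symm with h0 | h0 | h0
    · exact ⟨0, 0, by simp [h0]⟩
    · exact ⟨0, r k, by simp [h0]⟩
    · exact ⟨r k, 0, by simp [h0]⟩
  refine ⟨i, j, k, r i, r j, t, u + r₄, hij.symm, hjk, hik, hi, by simp [hj], ?_⟩
  rw [hZ]
  ext x
  simp only [Set.mem_ofPred_eq, hsum, hpi, hpj, htu, pow_one, add_assoc]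
end

section
/- Let F : ℂ³ → ℂ³ be a dominant polynomial mapping of degree 2 with S_F ≠ ∅. Then S_F cannot contain two distinct paraboloids. -/
open Filter Topology

open MvPolynomial

lemma finrank_restrictTotalDegree (K : Type*) [Field K] (n e : ℕ) :
    Module.finrank K (restrictTotalDegree (Fin n) K e) = (e + n).choose n := by
  classical
  have hset : {s : Fin n →₀ ℕ | (s.sum fun _ k => k) ≤ e} =
      ↑((Finset.range (e + 1)).biUnion fun k => (Finset.univ : Finset (Fin n)).finsuppAntidiag k) := by
    ext s
    simp [Finset.mem_finsuppAntidiag, Finsupp.sum_fintype]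
  have hb := Module.finrank_eq_nat_card_basis
    (basisRestrictSupport K {s : Fin n →₀ ℕ | (s.sum fun _ k => k) ≤ e})
  rw [restrictTotalDegree, hb, hset, Nat.card_coe_set_eq, Set.ncard_coe_finset,
    Finset.card_biUnion]
  · simp only [Finset.card_finsuppAntidiag_nat_eq_multichoose, Finset.card_univ, Fintype.card_fin]
    exact Nat.sum_range_multichoose e n
  · intro a _ b _ hab
    rw [Function.onFun, Finset.disjoint_left]
    intro s hs ht
    rw [Finset.mem_finsuppAntidiag] at hs ht
    exact hab (hs.1.symm.trans ht.1)

lemma totalDegree_aeval_le {σ τ R : Type*} [CommRing R] {d : ℕ} {P : σ → MvPolynomial τ R}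
    (hP : ∀ i, (P i).totalDegree ≤ d) (A : MvPolynomial σ R) :
    (aeval P A).totalDegree ≤ d * A.totalDegree := by
  rw [aeval_def, eval₂_eq]
  refine totalDegree_finsetSum_le fun s hs => ?_
  refine (totalDegree_mul _ _).trans ?_
  rw [algebraMap_eq, totalDegree_C, zero_add]
  refine (totalDegree_finsetProd _ _).trans ?_
  refine le_trans (Finset.sum_le_sum fun i _ =>
    (totalDegree_pow _ _).trans (Nat.mul_le_mul_left _ (hP i))) ?_
  rw [← Finset.sum_mul, mul_comm]
  exact Nat.mul_le_mul_left _ (le_totalDegree hs)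

/-- A paraboloid is cut out by a prime polynomial of degree two which generates its ideal. -/
lemma IsParaboloid.exists_prime {H : Set (Fin 3 → ℂ)} (hH : IsParaboloid H) :
    ∃ q : MvPolynomial (Fin 3) ℂ, Prime q ∧ q.totalDegree = 2 ∧ H = {x | eval x q = 0} ∧
      ∀ A : MvPolynomial (Fin 3) ℂ, (∀ x ∈ H, eval x A = 0) → q ∣ A := by
  obtain ⟨i, j, l, r, s, t, u, hij, hjl, hil, hr, hst, rfl⟩ := hH
  wlog hs : s ≠ 0 generalizing j l s t
  · have ht : t ≠ 0 := by
      rintro rfl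
      exact hst (by simpa using hs)
    have := this l j t s hil hjl.symm hij (by simp [ht]) ht
    simpa only [add_right_comm _ (t * _) (s * _)] using this
  set q : MvPolynomial (Fin 3) ℂ := C r * X i ^ 2 + C s * X j + C t * X l + C u with hq
  have heval : ∀ x, eval x q = r * x i ^ 2 + s * x j + t * x l + u := by simp [hq]
  set g : MvPolynomial (Fin 3) ℂ := C (-s⁻¹) * (C r * X i ^ 2 + C t * X l + C u) with hg
  set φ : MvPolynomial (Fin 3) ℂ →ₐ[ℂ] MvPolynomial (Fin 3) ℂ :=
    aeval (Function.update X j g) with hφ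
  have hφq : φ q = 0 := by
    have hss : (C s * C s⁻¹ : MvPolynomial (Fin 3) ℂ) = 1 := by
      rw [← C_mul, mul_inv_cancel₀ hs, C_1]
    simp only [hφ, hq, hg, map_add, map_mul, map_pow, aeval_X, aeval_C, algebraMap_eq,
      Function.update_self, Function.update_of_ne hij, Function.update_of_ne hjl.symm, C_neg]
    linear_combination -(C r * X i ^ 2 + C t * X l + C u) * hss
  have hXg : q ∣ X j - g := by
    refine ⟨C s⁻¹, ?_⟩
    have hss : (C s * C s⁻¹ : MvPolynomial (Fin 3) ℂ) = 1 := by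
      rw [← C_mul, mul_inv_cancel₀ hs, C_1]
    simp only [hq, hg, C_neg]
    linear_combination -X j * hss
  have hdvd_sub : ∀ A, q ∣ A - φ A := by
    intro A
    rw [← Ideal.mem_span_singleton, ← Ideal.Quotient.eq]
    have : (Ideal.Quotient.mkₐ ℂ (Ideal.span {q})) =
        (Ideal.Quotient.mkₐ ℂ (Ideal.span {q})).comp φ := by
      ext k
      simp only [hφ, AlgHom.comp_apply, aeval_X]
      rcases eq_or_ne k j with rfl | hk
      · rw [Function.update_self]
        exact Ideal.Quotient.eq.2 (Ideal.mem_span_singleton.2 hXg)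
      · rw [Function.update_of_ne hk]
    exact DFunLike.congr_fun this A
  have hφ_dvd : ∀ A, φ A = 0 → q ∣ A := fun A hA => by simpa [hA] using hdvd_sub A
  have hdvd_φ : ∀ A, q ∣ A → φ A = 0 := by
    rintro _ ⟨B, rfl⟩
    rw [map_mul, hφq, zero_mul]
  have hcoeff : coeff (Finsupp.single i 2) q = r := by
    simp [hq, coeff_C_mul, coeff_X_pow, coeff_X, coeff_C, Finsupp.single_eq_single_iff]
    exact fun h => absurd h.symm (by simp)
  have hdeg : q.totalDegree = 2 := by
    apply le_antisymm
    · have h1 : ∀ (a : ℂ) (k : Fin 3), (C a * X k : MvPolynomial (Fin 3) ℂ).totalDegree ≤ 2 :=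
        fun a k => (totalDegree_mul _ _).trans (by simp)
      have h2 : (C r * X i ^ 2 : MvPolynomial (Fin 3) ℂ).totalDegree ≤ 2 :=
        (totalDegree_mul _ _).trans (by simp)
      refine (totalDegree_add _ _).trans (max_le ((totalDegree_add _ _).trans
        (max_le ((totalDegree_add _ _).trans (max_le h2 (h1 s j))) (h1 t l))) (by simp))
    · have := le_totalDegree (p := q) (s := Finsupp.single i 2)
        (by rw [mem_support_iff, hcoeff]; exact hr)
      simpa using this
  refine ⟨q, ⟨?_, ?_, ?_⟩, hdeg, by simp only [heval], ?_⟩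
  · rintro h
    simp [h] at hdeg
  · intro h
    have := hdvd_φ 1 h.dvd
    simp at this
  · intro A B hAB
    have := hdvd_φ _ hAB
    rw [map_mul, mul_eq_zero] at this
    exact this.imp (hφ_dvd A) (hφ_dvd B)
  · intro A hA
    refine hφ_dvd A (MvPolynomial.funext fun x => ?_)
    have hx : eval x (φ A) = eval (Function.update x j (eval x g)) A := by
      have : (aeval x).comp φ = aeval (R := ℂ) (Function.update x j (eval x g)) := by
        ext k
        rcases eq_or_ne k j with rfl | hk
        · simp [hφ]
        · simp [hφ, hk]
      simpa [coe_aeval_eq_eval] using DFunLike.congr_fun this A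
    rw [hx, map_zero]
    apply hA
    simp only [Set.mem_ofPred_eq, Function.update_self, Function.update_of_ne hij,
      Function.update_of_ne hjl.symm, hg, map_add, map_mul, map_pow, eval_C, eval_X]
    field_simp
    ring

lemma exists_submodule_forall_dvd_eq_zero {K : Type*} [Field K] {n : ℕ}
    (Q : MvPolynomial (Fin n) K) (e : ℕ) :
    ∃ U ≤ restrictTotalDegree (Fin n) K e, (∀ A ∈ U, Q ∣ A → A = 0) ∧
      (e + n).choose n ≤ Module.finrank K U + (e - Q.totalDegree + n).choose n := by
  set W := restrictTotalDegree (Fin n) K e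
  set M := (restrictTotalDegree (Fin n) K (e - Q.totalDegree)).map (LinearMap.mulLeft K Q)
  have hle : W ⊓ LinearMap.range (LinearMap.mulLeft K Q) ≤ M := by
    rintro _ ⟨hW, B, rfl⟩
    rw [LinearMap.mulLeft_apply, SetLike.mem_coe, mem_restrictTotalDegree] at hW
    by_cases h : Q * B = 0
    · rw [LinearMap.mulLeft_apply, h]
      exact zero_mem _
    · rw [totalDegree_mul_of_isDomain (left_ne_zero_of_mul h) (right_ne_zero_of_mul h)] at hW
      exact ⟨B, (mem_restrictTotalDegree _ _ _).2 (by omega), rfl⟩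
  obtain ⟨U, hdisj, hsup⟩ := IsModularLattice.exists_disjoint_and_sup_eq
    (inf_le_left : W ⊓ LinearMap.range (LinearMap.mulLeft K Q) ≤ W)
  have hUW : U ≤ W := hsup ▸ le_sup_right
  have : FiniteDimensional K U := Submodule.finiteDimensional_of_le hUW
  refine ⟨U, hUW, ?_, ?_⟩
  · rintro A hA ⟨B, rfl⟩
    exact Submodule.disjoint_def.1 hdisj _ ⟨hUW hA, B, rfl⟩ hA
  · have h1 : Module.finrank K W ≤ _ + Module.finrank K U :=
      hsup ▸ Submodule.finrank_add_le_finrank_add_finrank _ _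
    have h2 := (Submodule.finrank_mono hle).trans (Submodule.finrank_map_le _ _)
    rw [finrank_restrictTotalDegree] at h1 h2
    omega

/-- For a degree-two polynomial map `P` with algebraically independent coordinates and a linear
form `L`, a dimension count gives an algebraic relation for `L` over `ℂ[P]` whose leading
coefficient is not a multiple of a given quartic. -/
lemma exists_relation {P : Fin 3 → MvPolynomial (Fin 3) ℂ} (hP : ∀ i, (P i).totalDegree ≤ 2)
    (hinj : ∀ A : MvPolynomial (Fin 3) ℂ, aeval P A = 0 → A = 0)
    {L Q : MvPolynomial (Fin 3) ℂ} (hL : L.totalDegree ≤ 1) (hQ : Q.totalDegree = 4) :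
    ∃ (m : ℕ) (a : ℕ → MvPolynomial (Fin 3) ℂ), 1 ≤ m ∧ ¬ Q ∣ a m ∧
      ∑ j ∈ Finset.range (m + 1), aeval P (a j) * L ^ j = 0 := by
  by_contra! hcon
  choose V hVW hV hVrank using exists_submodule_forall_dvd_eq_zero Q
  set U : Fin 81 → Submodule ℂ (MvPolynomial (Fin 3) ℂ) := fun j =>
    if j = 0 then restrictTotalDegree (Fin 3) ℂ 40 else V ((80 - j) / 2) with hU
  have hUdeg : ∀ j, ∀ A ∈ U j, A.totalDegree ≤ (80 - (j : ℕ)) / 2 := by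
    intro j A hA
    simp only [hU] at hA
    split_ifs at hA with h
    · subst h
      exact (mem_restrictTotalDegree _ _ _).1 hA
    · exact (mem_restrictTotalDegree _ _ _).1 (hVW _ hA)
  have hfin : ∀ j, Module.Finite ℂ (U j) := fun j =>
    Submodule.finiteDimensional_of_le (S₂ := restrictTotalDegree (Fin 3) ℂ ((80 - (j : ℕ)) / 2))
      fun A hA => (mem_restrictTotalDegree _ _ _).2 (hUdeg j A hA)
  let Φ : (Π j, U j) →ₗ[ℂ] MvPolynomial (Fin 3) ℂ :=
    ∑ j : Fin 81, (LinearMap.mulRight ℂ (L ^ (j : ℕ))).comp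
      ((aeval P).toLinearMap.comp ((U j).subtype.comp (LinearMap.proj j)))
  have hΦ : ∀ u, Φ u = ∑ j : Fin 81, aeval P (u j : MvPolynomial (Fin 3) ℂ) * L ^ (j : ℕ) := by
    intro u
    simp [Φ]
  have hΦdeg : ∀ u, Φ u ∈ restrictTotalDegree (Fin 3) ℂ 80 := by
    intro u
    rw [hΦ, mem_restrictTotalDegree]
    refine totalDegree_finsetSum_le fun j _ => (totalDegree_mul _ _).trans ?_
    have h1 := totalDegree_aeval_le hP (u j : MvPolynomial (Fin 3) ℂ)
    have h2 := hUdeg j _ (u j).2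
    have h3 := (totalDegree_pow L (j : ℕ)).trans (Nat.mul_le_mul_left _ hL)
    have h4 := j.2
    omega
  have hΦinj : ∀ u, Φ u = 0 → u = 0 := by
    intro u hu
    by_contra hne
    obtain ⟨j, hj⟩ := Function.ne_iff.1 hne
    obtain ⟨m, hm, hmax⟩ := (Finset.univ.filter fun j => u j ≠ 0).exists_max_image id
      ⟨j, by simpa using hj⟩
    have hm0 : u m ≠ 0 := by simpa using hm
    have hzero : ∀ k, m < k → u k = 0 := by
      intro k hk
      by_contra h
      exact absurd (hmax k (by simpa using h)) (not_le.2 hk)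
    set a : ℕ → MvPolynomial (Fin 3) ℂ := fun k => if h : k < 81 then u ⟨k, h⟩ else 0 with ha
    have ham : a m = u m := by simp [ha]
    have hsum : ∑ k ∈ Finset.range ((m : ℕ) + 1), aeval P (a k) * L ^ k = 0 := by
      rw [Finset.sum_subset (Finset.range_mono (Nat.succ_le_of_lt m.2)), ← hu, hΦ,
        Finset.sum_range]
      · simp [ha]
      · intro k hk hk'
        rw [Finset.mem_range] at hk hk'
        have hmk : m < ⟨k, hk⟩ := Fin.lt_def.2 (show (m : ℕ) < k by omega)
        simp only [ha, dif_pos hk, hzero _ hmk, Submodule.coe_zero, map_zero, zero_mul]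
    rcases eq_or_ne m 0 with rfl | hmne
    · have := hinj (a 0) (by simpa using hsum)
      exact hm0 (Subtype.ext (ham.symm.trans this))
    · refine hcon m a (Nat.one_le_iff_ne_zero.2 (fun h => hmne (Fin.ext h))) ?_ hsum
      intro hdvd
      have hmem : a m ∈ V ((80 - (m : ℕ)) / 2) := by
        rw [ham]
        have := (u m).2
        simpa only [hU, if_neg hmne] using this
      exact hm0 (Subtype.ext (ham.symm.trans (hV _ _ hmem hdvd)))
  have hrank := LinearMap.finrank_le_finrank_of_injective
    (f := Φ.codRestrict _ hΦdeg) (by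
      rw [← LinearMap.ker_eq_bot, LinearMap.ker_codRestrict, LinearMap.ker_eq_bot']
      exact hΦinj)
  rw [Module.finrank_pi_fintype, finrank_restrictTotalDegree, Fin.sum_univ_succ] at hrank
  have h0 : Module.finrank ℂ (U 0) = 12341 := by
    have : U 0 = restrictTotalDegree (Fin 3) ℂ 40 := by simp [hU]
    rw [this, finrank_restrictTotalDegree]
    decide +kernel
  have hsucc : ∑ j : Fin 80, (((80 - ((j : ℕ) + 1)) / 2 + 3).choose 3 : ℕ) ≤
      ∑ j : Fin 80, Module.finrank ℂ (U j.succ) +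
        ∑ j : Fin 80, ((80 - ((j : ℕ) + 1)) / 2 - 4 + 3).choose 3 := by
    rw [← Finset.sum_add_distrib]
    refine Finset.sum_le_sum fun j _ => ?_
    have := hVrank ((80 - ((j : ℕ) + 1)) / 2)
    rw [hQ] at this
    have hUj : U j.succ = V ((80 - ((j : ℕ) + 1)) / 2) := if_neg (Fin.succ_ne_zero j)
    rwa [hUj]
  have hnum : (80 + 3).choose 3 + ∑ j : Fin 80, ((80 - ((j : ℕ) + 1)) / 2 - 4 + 3 : ℕ).choose 3 <
      12341 + ∑ j : Fin 80, (((80 - ((j : ℕ) + 1)) / 2 + 3).choose 3 : ℕ) := by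
    simp only [Finset.sum_fin_eq_sum_range]
    decide +kernel
  omega

/-- Roots of polynomials whose coefficients converge remain bounded if the limit of the leading
coefficients is nonzero. -/
lemma exists_eventually_norm_le_of_sum_eq_zero {m : ℕ} {α : ℕ → ℕ → ℂ} {β : ℕ → ℂ} {z : ℕ → ℂ}
    (hα : ∀ j, Tendsto (α j) atTop (𝓝 (β j))) (hm : 1 ≤ m) (hβ : β m ≠ 0)
    (hz : ∀ k, ∑ j ∈ Finset.range (m + 1), α j k * z k ^ j = 0) :
    ∃ B : ℝ, ∀ᶠ k in atTop, ‖z k‖ ≤ B := by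
  obtain ⟨n, rfl⟩ : ∃ n, m = n + 1 := ⟨m - 1, by omega⟩
  set c := ‖β (n + 1)‖ / 2
  have hc : 0 < c := half_pos (norm_pos_iff.2 hβ)
  set M := ∑ j ∈ Finset.range (n + 1), (‖β j‖ + 1)
  have hlow : ∀ᶠ k in atTop, c ≤ ‖α (n + 1) k‖ :=
    (hα (n + 1)).norm.eventually_const_le (half_lt_self (norm_pos_iff.2 hβ))
  have hup : ∀ᶠ k in atTop, ∀ j ∈ Finset.range (n + 1), ‖α j k‖ ≤ ‖β j‖ + 1 :=
    (Filter.eventually_all_finset _).2 fun j _ =>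
      (hα j).norm.eventually_le_const (lt_add_one _)
  refine ⟨max 1 (M / c), ?_⟩
  filter_upwards [hlow, hup] with k hk hk'
  rcases le_total ‖z k‖ 1 with h1 | h1
  · exact h1.trans (le_max_left _ _)
  · refine le_trans ?_ (le_max_right _ _)
    rw [le_div_iff₀ hc]
    have hzk := hz k
    rw [Finset.sum_range_succ, add_comm, add_eq_zero_iff_eq_neg] at hzk
    have hpow : 0 < ‖z k‖ ^ n := pow_pos (by linarith) _
    refine le_of_mul_le_mul_right ?_ hpow
    calc ‖z k‖ * c * ‖z k‖ ^ n = c * ‖z k‖ ^ (n + 1) := by ring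
      _ ≤ ‖α (n + 1) k * z k ^ (n + 1)‖ := by
        rw [norm_mul, norm_pow]
        gcongr
      _ = ‖∑ j ∈ Finset.range (n + 1), α j k * z k ^ j‖ := by rw [hzk, norm_neg]
      _ ≤ ∑ j ∈ Finset.range (n + 1), (‖β j‖ + 1) * ‖z k‖ ^ n := by
        refine norm_sum_le_of_le _ fun j hj => ?_
        rw [norm_mul, norm_pow]
        have := hk' j hj
        have hjn : j ≤ n := Nat.lt_succ_iff.1 (Finset.mem_range.1 hj)
        gcongr
      _ = M * ‖z k‖ ^ n := by rw [← Finset.sum_mul]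

/-- A sequence in `ℂⁿ` is bounded as soon as `n` Vandermonde linear forms are bounded on it. -/
lemma not_tendsto_norm_atTop_of_vandermonde {n : ℕ} {f : Fin n → ℂ} (hf : Function.Injective f)
    {ξ : ℕ → Fin n → ℂ}
    (hb : ∀ i, ∃ B : ℝ, ∀ᶠ k in atTop, ‖∑ j : Fin n, f i ^ (j : ℕ) * ξ k j‖ ≤ B) :
    ¬ Tendsto (fun k => ‖ξ k‖) atTop atTop := by
  intro htend
  choose B hB using hb
  obtain ⟨K, -, hK⟩ := (Matrix.toLin' (Matrix.vandermonde f)).exists_antilipschitzWith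
    (LinearMap.ker_eq_bot'.2 fun v hv =>
      Matrix.eq_zero_of_forall_index_sum_pow_mul_eq_zero hf fun j => congrFun hv j)
  obtain ⟨k, hk, hlt⟩ := ((Filter.eventually_all.2 hB).and
    (htend.eventually_gt_atTop (K * ∑ i, |B i|))).exists
  refine absurd hlt (not_lt.2 ?_)
  have h1 := hK.le_mul_dist (ξ k) 0
  rw [map_zero, dist_zero_right, dist_zero_right] at h1
  refine h1.trans (mul_le_mul_of_nonneg_left ?_ K.2)
  refine (pi_norm_le_iff_of_nonneg (Finset.sum_nonneg fun i _ => abs_nonneg _)).2 fun i => ?_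
  exact (hk i).trans ((le_abs_self _).trans
    (Finset.single_le_sum (f := fun i => |B i|) (fun i _ => abs_nonneg _) (Finset.mem_univ i)))

/-- The asymptotic set of a non-proper dominant degree-2 polynomial mapping `F : ℂ³ → ℂ³`
cannot contain two distinct paraboloids. -/
theorem not_two_paraboloids
    (P : Fin 3 → MvPolynomial (Fin 3) ℂ) (F : (Fin 3 → ℂ) → (Fin 3 → ℂ))
    (hP : IsDegTwoPolyMap P F)
    (hdom : Dense (Set.range F))
    (hne : asymptoticSet F ≠ ∅) :
    ¬ ∃ H₁ H₂ : Set (Fin 3 → ℂ), IsParaboloid H₁ ∧ IsParaboloid H₂ ∧ H₁ ≠ H₂ ∧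
      H₁ ⊆ asymptoticSet F ∧ H₂ ⊆ asymptoticSet F := by
  rintro ⟨H₁, H₂, hH₁, hH₂, hH, hS₁, hS₂⟩
  obtain ⟨hF, hdeg, -⟩ := hP
  obtain ⟨q₁, hq₁, hd₁, hZ₁, hI₁⟩ := hH₁.exists_prime
  obtain ⟨q₂, hq₂, hd₂, hZ₂, hI₂⟩ := hH₂.exists_prime
  have heval : ∀ x A, eval x (aeval P A) = eval (F x) A := by
    intro x A
    have : (aeval x).comp (aeval P) = aeval (R := ℂ) (F x) := by
      ext k
      simp [hF]
    simpa [coe_aeval_eq_eval] using DFunLike.congr_fun this A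
  have hinj : ∀ A : MvPolynomial (Fin 3) ℂ, aeval P A = 0 → A = 0 := by
    intro A hA
    have : (fun y => eval y A) = fun _ => 0 := by
      refine (MvPolynomial.continuous_eval A).ext_on hdom continuous_const ?_
      rintro _ ⟨x, rfl⟩
      simp only [← heval, hA, map_zero]
    exact MvPolynomial.funext fun y => by simpa using congrFun this y
  have hndvd : ¬ q₂ ∣ q₁ := by
    rintro h
    refine hH ?_
    have := (hq₂.dvd_prime_iff_associated hq₁).1 h
    obtain ⟨w, hw⟩ := this
    rw [hZ₁, hZ₂]
    ext x
    have hu : eval x (w : MvPolynomial (Fin 3) ℂ) ≠ 0 := (w.isUnit.map (eval x)).ne_zero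
    simp [← hw, hu]
  set L : ℂ → MvPolynomial (Fin 3) ℂ := fun c => ∑ i : Fin 3, C (c ^ (i : ℕ)) * X i with hL
  have hLdeg : ∀ c, (L c).totalDegree ≤ 1 := fun c =>
    totalDegree_finsetSum_le fun i _ => (totalDegree_mul _ _).trans (by rw [totalDegree_C, totalDegree_X])
  have hQ : (q₁ * q₂).totalDegree = 4 := by
    rw [totalDegree_mul_of_isDomain hq₁.ne_zero hq₂.ne_zero, hd₁, hd₂]
  choose m a hm hdvd hrel using fun c => exists_relation hdeg hinj (hLdeg c) hQ
  have key : ∀ (H : Set (Fin 3 → ℂ)) (q : MvPolynomial (Fin 3) ℂ), Prime q →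
      (∀ A : MvPolynomial (Fin 3) ℂ, (∀ x ∈ H, eval x A = 0) → q ∣ A) → H ⊆ asymptoticSet F →
      {c | ¬ q ∣ a c (m c)}.Finite := by
    intro H q hq hI hS
    by_contra hinf
    let g := Set.Infinite.natEmbedding _ hinf
    let f : Fin 3 → ℂ := fun i => g i
    have hf : Function.Injective f := fun i j hij =>
      Fin.ext (g.injective (Subtype.ext hij))
    have hprod : ¬ q ∣ ∏ i, a (f i) (m (f i)) := by
      rw [hq.dvd_finsetProd_iff]
      rintro ⟨i, -, hi⟩
      exact (g i).2 hi
    obtain ⟨b, hb, hb0⟩ : ∃ b ∈ H, eval b (∏ i, a (f i) (m (f i))) ≠ 0 := by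
      by_contra! h
      exact hprod (hI _ h)
    rw [map_prod, Finset.prod_ne_zero_iff] at hb0
    obtain ⟨ξ, hξ, hFξ⟩ := hS hb
    refine not_tendsto_norm_atTop_of_vandermonde hf (fun i => ?_) hξ
    refine exists_eventually_norm_le_of_sum_eq_zero
      (α := fun j k => eval (F (ξ k)) (a (f i) j)) (β := fun j => eval b (a (f i) j))
      (fun j => ((MvPolynomial.continuous_eval _).tendsto b).comp hFξ) (hm (f i))
      (hb0 i (Finset.mem_univ i)) fun k => ?_
    have hev := congrArg (eval (ξ k)) (hrel (f i))
    simp only [map_sum, map_mul, map_pow, heval, hL, eval_C, eval_X, map_zero] at hev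
    exact hev
  refine Set.infinite_univ (((key H₁ q₁ hq₁ hI₁ hS₁).union (key H₂ q₂ hq₂ hI₂ hS₂)).subset
    fun c _ => ?_)
  by_contra h
  rw [Set.mem_union, not_or] at h
  obtain ⟨B, hB⟩ := not_not.1 h.1
  have h2 := not_not.1 h.2
  rw [hB] at h2
  obtain ⟨D, rfl⟩ := (hq₂.dvd_or_dvd h2).resolve_left hndvd
  exact hdvd c ⟨D, by rw [hB, mul_assoc]⟩
end
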